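/- arXiv:1308.0154 — 3 statements merged into one kernel-verified Lean document; each statement's English description precedes it below -/
import Mathlib

section
/- Let k be an algebraically closed field, A = k[X,Y], and suppose F ∈ A is rectangular with respect to (X,Y) and |Γ_alg(F,A)| ≥ 2. Suppose v(Y) ∈ k[Y] \ k is such that F is a variable of A' = k[X·v(Y), Y]. Then F = c·X·v(Y) + w(Y) for some c ∈ k* and w(Y) ∈ k[Y] with deg w(Y) ≤ deg v(Y). -/
open MvPolynomial

/-- The set `Γ_alg(F,A)` of primes `p` of `A = k[X,Y]` such that the composite
`k[F] ↪ A → A/p` is an isomorphism. -/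
def GammaAlg (k : Type) [Field k] (F : MvPolynomial (Fin 2) k) :
    Set (Ideal (MvPolynomial (Fin 2) k)) :=
  {p | p.IsPrime ∧ Function.Bijective
    (fun q : Polynomial k => Ideal.Quotient.mk p (Polynomial.aeval F q))}

theorem noetherian_injective_of_surjective {R : Type*} [CommRing R] [IsNoetherianRing R]
    (f : R →+* R) (hf : Function.Surjective f) : Function.Injective f := by
  let g : ℕ →o Ideal R :=
    ⟨fun n => RingHom.ker (f ^ n), monotone_nat_of_le_succ fun n x hx => by
      rw [RingHom.mem_ker] at hx ⊢
      rw [pow_succ', RingHom.mul_def, RingHom.comp_apply, hx, map_zero]⟩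
  obtain ⟨n, hn⟩ := monotone_stabilizes_iff_noetherian.mpr ‹IsNoetherianRing R› g
  rw [injective_iff_map_eq_zero]
  intro x hx
  have hs : Function.Surjective (f ^ n : R →+* R) := by
    rw [RingHom.coe_pow]; exact hf.iterate n
  obtain ⟨y, rfl⟩ := hs x
  have hy : y ∈ g (n + 1) := by
    change y ∈ RingHom.ker (f ^ (n + 1))
    rw [RingHom.mem_ker, pow_succ', RingHom.mul_def, RingHom.comp_apply, hx]
  rw [← hn (n + 1) n.le_succ] at hy
  exact hy

namespace Polynomial

variable {k : Type*} [Field k]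

theorem range_aevalAeval {A : Type*} [CommRing A] [Algebra k A] (x y : A) :
    (aevalAeval x y : k[X][X] →ₐ[k] A).range = Algebra.adjoin k {y, x} := by
  apply le_antisymm
  · rintro _ ⟨p, rfl⟩
    induction p using Polynomial.induction_on' with
    | add p q hp hq => simpa using add_mem hp hq
    | monomial n a =>
      rw [← C_mul_X_pow_eq_monomial]
      have hx : x ∈ Algebra.adjoin k {y, x} := Algebra.subset_adjoin (by simp)
      have hy : y ∈ Algebra.adjoin k {y, x} := Algebra.subset_adjoin (by simp)
      have ha : aeval x a ∈ Algebra.adjoin k {y, x} :=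
        Algebra.adjoin_mono (by simp) (aeval_mem_adjoin_singleton k x)
      simpa using mul_mem ha (pow_mem hy n)
  · rw [Algebra.adjoin_le_iff]
    rintro z (rfl | rfl)
    · exact ⟨X, by simp⟩
    · exact ⟨C X, by simp⟩

theorem adjoin_X_C_X : Algebra.adjoin k {(X : k[X][X]), C X} = ⊤ := by
  rw [← range_aevalAeval, AlgHom.range_eq_top]
  have : (aevalAeval (C X) X : k[X][X] →ₐ[k] k[X][X]) = AlgHom.id k _ := by
    ext <;> simp
  rw [this]
  exact Function.surjective_id

theorem natDegree_eq_natDegree_of_ker_eq_span {B : Type*} [CommRing B] [Algebra k B]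
    {φ ψ : B →ₐ[k] k[X]} (hφ : Function.Surjective φ) (hψ : Function.Surjective ψ) {P H : B}
    (hP : RingHom.ker φ = Ideal.span {P}) (hH : RingHom.ker ψ = Ideal.span {H}) :
    (φ H).natDegree = (ψ P).natDegree := by
  have key : ∀ {φ : B →ₐ[k] k[X]} (_ : Function.Surjective φ) {P : B}
      (_ : RingHom.ker φ = Ideal.span {P}) (H : B),
      (φ H).natDegree = Module.finrank k (B ⧸ (Ideal.span {H} ⊔ Ideal.span {P})) := by
    intro φ hφ P hP H
    rw [← finrank_quotient_span_eq_natDegree]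
    let g : B →ₐ[k] k[X] ⧸ Ideal.span {φ H} := (Ideal.Quotient.mkₐ k _).comp φ
    have hg : Function.Surjective g := (Ideal.Quotient.mkₐ_surjective k _).comp hφ
    have hk : RingHom.ker g = Ideal.span {H} ⊔ Ideal.span {P} := by
      rw [← hP, RingHom.ker_eq_comap_bot φ, ← Ideal.comap_map_of_surjective φ hφ, Ideal.map_span,
        Set.image_singleton]
      ext x
      simp [g, RingHom.mem_ker, Ideal.Quotient.eq_zero_iff_mem]
    exact ((Ideal.quotientEquivAlgOfEq k hk.symm).trans
      (Ideal.quotientKerAlgEquivOfSurjective hg)).toLinearEquiv.finrank_eq.symm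
  rw [key hφ hP, key hψ hH, sup_comm]

/-- Evaluation of the outer variable of `k[X][X]`, as a `k`-algebra map. -/
noncomputable def outerEval (u : k[X]) : k[X][X] →ₐ[k] k[X] :=
  (aeval u : k[X][X] →ₐ[k[X]] k[X]).restrictScalars k

theorem outerEval_apply (u : k[X]) (p : k[X][X]) : outerEval u p = p.eval u := by
  simp [outerEval, aeval_def, eval₂_eq_eval_map]

theorem outerEval_surjective (u : k[X]) : Function.Surjective (outerEval u) :=
  fun p => ⟨C p, by simp [outerEval_apply]⟩

theorem ker_outerEval (u : k[X]) : RingHom.ker (outerEval u) = Ideal.span {X - C u} := by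
  rw [← ker_evalRingHom]
  ext p
  simp [RingHom.mem_ker, outerEval_apply]

theorem mapAlgHom_aeval_surjective (y : k) :
    Function.Surjective (mapAlgHom (aeval y : k[X] →ₐ[k] k)) := by
  intro p
  refine ⟨p.map C, ?_⟩
  ext i
  simp [coeff_map]

theorem ker_mapAlgHom_aeval (y : k) :
    RingHom.ker (mapAlgHom (aeval y : k[X] →ₐ[k] k)) = Ideal.span {C (X - C y)} := by
  have h1 := Polynomial.ker_mapRingHom (evalRingHom y)
  rw [ker_evalRingHom, Ideal.map_span, Set.image_singleton] at h1
  rw [← h1]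
  ext p
  simp only [RingHom.mem_ker, coe_mapAlgHom, coe_mapRingHom]
  rfl

theorem algHom_C_eq_comp (χ : k[X][X] →ₐ[k] k[X]) (q : k[X]) : χ (C q) = q.comp (χ (C X)) := by
  have : (χ.comp (Polynomial.CAlgHom : k[X] →ₐ[k] k[X][X])) = aeval (χ (C X)) := by
    ext; simp [CAlgHom]
  exact DFunLike.congr_fun this q

/-- If `P` generates the kernel of a surjection `φ : k[X][X] → k[X]` and has positive degree, then
its leading coefficient is constant, and its degree is that of `φ (C X)`. -/
theorem natDegree_algHom_C_X_eq [IsAlgClosed k] {φ : k[X][X] →ₐ[k] k[X]} (hφ : Function.Surjective φ)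
    {P : k[X][X]} (hP : RingHom.ker φ = Ideal.span {P}) (h0 : 0 < P.natDegree) :
    (φ (C X)).natDegree = P.natDegree ∧ P.leadingCoeff.natDegree = 0 := by
  have h (y : k) : (φ (C X)).natDegree = (P.map (evalRingHom y)).natDegree := by
    have := natDegree_eq_natDegree_of_ker_eq_span hφ (mapAlgHom_aeval_surjective y) hP
      (ker_mapAlgHom_aeval y)
    have e : φ (C (X - C y)) = φ (C X) - C y := by
      rw [C_sub, map_sub]
      congr 1
      exact φ.commutes y
    rw [e, natDegree_sub_C] at this
    exact this
  have hne : P.leadingCoeff ≠ 0 := leadingCoeff_ne_zero.mpr (by rintro rfl; simp at h0)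
  obtain ⟨y, hy⟩ : ∃ y, P.leadingCoeff.eval y ≠ 0 := by
    by_contra! hc
    exact hne (Polynomial.funext (by simpa using hc))
  have hm : (φ (C X)).natDegree = P.natDegree := by
    rw [h y]
    exact natDegree_map_of_leadingCoeff_ne_zero _ hy
  refine ⟨hm, ?_⟩
  by_contra hd
  obtain ⟨z, hz⟩ := IsAlgClosed.exists_root P.leadingCoeff
    (fun h => hd (natDegree_eq_of_degree_eq_some h))
  have h2 := h z
  rw [hm] at h2
  have : (P.map (evalRingHom z)).leadingCoeff ≠ 0 :=
    leadingCoeff_ne_zero.mpr (by rintro h; rw [h] at h2; simp at h2; omega)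
  rw [leadingCoeff, ← h2, coeff_map] at this
  exact this hz

theorem natDegree_eq_one_of_eval [IsAlgClosed k] {φ : k[X][X] →ₐ[k] k[X]}
    (hφ : Function.Surjective φ) {P : k[X][X]} (hP : RingHom.ker φ = Ideal.span {P})
    (h0 : 0 < P.natDegree) {v : k[X]} (hv : 0 < v.natDegree) {a₁ a₂ : k} (ha : a₁ ≠ a₂)
    (h₁ : (P.eval (C a₁ * v)).natDegree = 1) (h₂ : (P.eval (C a₂ * v)).natDegree = 1) :
    P.natDegree = 1 := by
  have key (a : k) (h : (P.eval (C a * v)).natDegree = 1) :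
      (φ (X - C (C a * v))).natDegree = 1 := by
    rw [natDegree_eq_natDegree_of_ker_eq_span hφ (outerEval_surjective _) hP (ker_outerEval _),
      outerEval_apply, h]
  have e : C (a₁ - a₂) * v.comp (φ (C X)) = φ (X - C (C a₂ * v)) - φ (X - C (C a₁ * v)) := by
    rw [map_sub φ, map_sub φ, algHom_C_eq_comp φ (C a₁ * v), algHom_C_eq_comp φ (C a₂ * v), mul_comp, mul_comp,
      C_comp, C_comp, C_sub]
    ring
  have h3 : (C (a₁ - a₂) * v.comp (φ (C X))).natDegree ≤ 1 := by
    rw [e]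
    exact (natDegree_sub_le _ _).trans (by rw [key _ h₁, key _ h₂]; simp)
  rw [natDegree_C_mul (sub_ne_zero.mpr ha), natDegree_comp, (natDegree_algHom_C_X_eq hφ hP h0).1] at h3
  nlinarith

theorem algHom_comp_C_mul_X (χ : k[X][X] →ₐ[k] k[X]) (P : k[X][X]) (v : k[X]) :
    χ (P.comp (C v * X)) =
      ∑ i ∈ Finset.range (P.natDegree + 1),
        (P.coeff i).comp (χ (C X)) * (v.comp (χ (C X)) * χ X) ^ i := by
  rw [comp, eval₂_eq_sum_range, map_sum]
  refine Finset.sum_congr rfl fun i _ => ?_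
  rw [map_mul, map_pow, map_mul, algHom_C_eq_comp, algHom_C_eq_comp χ v]

theorem natDegree_section_eq_zero {χ : k[X][X] →ₐ[k] k[X]} {P : k[X][X]} {v : k[X]}
    (hv : 0 < v.natDegree) (h2 : 2 ≤ P.natDegree) (hl : P.leadingCoeff.natDegree = 0)
    (hb : ∀ i, P.coeff i ≠ 0 → (P.coeff i).natDegree + v.natDegree * i ≤ v.natDegree * P.natDegree)
    (hχ : χ (P.comp (C v * X)) = X) : (χ X).natDegree = 0 := by
  rw [algHom_comp_C_mul_X] at hχ
  generalize χ X = a at *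
  generalize χ (C X) = b at *
  by_contra ha
  have ha0 : a ≠ 0 := by rintro rfl; simp at ha
  have hX : (X : k[X]).natDegree = 1 := natDegree_X
  by_cases hvb : v.comp b = 0
  · have hbc : b.natDegree = 0 := by
      have := natDegree_comp (p := v) (q := b)
      rw [hvb, natDegree_zero] at this
      exact (Nat.mul_eq_zero.mp this.symm).resolve_left hv.ne'
    rw [Finset.sum_range_succ', hvb, Finset.sum_eq_zero (fun i _ => by simp)] at hχ
    rw [← hχ] at hX
    simp [natDegree_comp, hbc] at hX
  · set w := v.comp b * a with hw
    have hwd : w.natDegree = v.natDegree * b.natDegree + a.natDegree := by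
      rw [hw, natDegree_mul hvb ha0, natDegree_comp]
    have hlow : (∑ i ∈ Finset.range P.natDegree, (P.coeff i).comp b * w ^ i).natDegree
        ≤ P.natDegree * w.natDegree - 1 := by
      apply natDegree_sum_le_of_forall_le
      intro i hi
      rw [Finset.mem_range] at hi
      by_cases hPi : P.coeff i = 0
      · simp [hPi]
      · refine natDegree_mul_le.trans ?_
        rw [natDegree_comp, natDegree_pow]
        obtain ⟨j, hj⟩ := Nat.exists_eq_add_of_lt hi
        have h3 := hb i hPi
        rw [hj] at h3 ⊢
        have h4 : (P.coeff i).natDegree ≤ v.natDegree * (j + 1) := by nlinarith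
        have h5 : (P.coeff i).natDegree * b.natDegree ≤ v.natDegree * (j + 1) * b.natDegree :=
          Nat.mul_le_mul_right _ h4
        apply Nat.le_sub_one_of_lt
        have h6 : 0 < a.natDegree := Nat.pos_of_ne_zero ha
        rw [hwd]
        nlinarith
    have htop : ((P.coeff P.natDegree).comp b * w ^ P.natDegree).natDegree
        = P.natDegree * w.natDegree := by
      rw [coeff_natDegree, eq_C_of_natDegree_eq_zero hl, C_comp, natDegree_C_mul, natDegree_pow]
      intro h
      have : P.leadingCoeff = 0 := by rw [eq_C_of_natDegree_eq_zero hl, h, C_0]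
      rw [leadingCoeff_eq_zero] at this
      simp [this] at h2
    have hpos : 2 ≤ P.natDegree * w.natDegree := by
      have : 0 < w.natDegree := by omega
      nlinarith
    rw [Finset.sum_range_succ] at hχ
    rw [← hχ, natDegree_add_eq_right_of_natDegree_lt (by rw [htop]; omega), htop] at hX
    omega

theorem algHom_comp_eq_of_section_const {χ : k[X][X] →ₐ[k] k[X]} {P : k[X][X]} {v : k[X]} {a : k}
    (ha : χ X = C a) : χ (P.comp (C v * X)) = (P.eval (C a * v)).comp (χ (C X)) := by
  rw [algHom_comp_C_mul_X, ha, eval_eq_sum_range, Polynomial.sum_comp]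
  simp [mul_comm]

/-- The substitution of `v X` for the outer variable `X` of `k[X][X]`. -/
noncomputable def outerCompAlgHom (v : k[X]) : k[X][X] →ₐ[k] k[X][X] :=
  (aeval (C v * X) : k[X][X] →ₐ[k[X]] k[X][X]).restrictScalars k

theorem outerCompAlgHom_apply (v : k[X]) (p : k[X][X]) :
    outerCompAlgHom v p = p.comp (C v * X) := by
  simp [outerCompAlgHom, comp_eq_aeval]

theorem outerCompAlgHom_injective {v : k[X]} (hv : v ≠ 0) :
    Function.Injective (outerCompAlgHom v) := by
  intro p q h
  ext1 i
  have := congrArg (fun r => coeff r i) h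
  simpa [outerCompAlgHom_apply, comp_C_mul_X_coeff, hv] using this

theorem eq_linear_of_two_sections [IsAlgClosed k] {P Q : k[X][X]} {v : k[X]}
    (hτ : Function.Surjective (aevalAeval Q P : k[X][X] →ₐ[k] k[X][X])) (hv : 0 < v.natDegree)
    {m n : ℕ} (hm : 1 ≤ m) (hdeg : (P.comp (C v * X)).natDegree ≤ m)
    (hcoeff : ∀ i, ((P.comp (C v * X)).coeff i).natDegree ≤ n)
    (hmn : ((P.comp (C v * X)).coeff m).coeff n ≠ 0)
    {χ₁ χ₂ : k[X][X] →ₐ[k] k[X]} (h₁ : χ₁ (P.comp (C v * X)) = X)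
    (h₂ : χ₂ (P.comp (C v * X)) = X) (hne : χ₁ ≠ χ₂) :
    ∃ (c : k) (w : k[X]), c ≠ 0 ∧ w.degree ≤ v.degree ∧
      P.comp (C v * X) = C (C c * v) * X + C w := by
  have hv0 : v ≠ 0 := by rintro rfl; simp at hv
  have hdegP : P.natDegree = m := by
    rw [natDegree_comp, natDegree_C_mul_X _ hv0, mul_one] at hdeg
    refine hdeg.antisymm (le_natDegree_of_ne_zero fun h => hmn ?_)
    simp [comp_C_mul_X_coeff, h]
  let τ := AlgEquiv.ofBijective (aevalAeval Q P : k[X][X] →ₐ[k] k[X][X])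
    ⟨noetherian_injective_of_surjective (aevalAeval Q P : k[X][X] →ₐ[k] k[X][X]).toRingHom hτ, hτ⟩
  have hτX : τ X = P := show aevalAeval Q P X = P by simp
  let φ : k[X][X] →ₐ[k] k[X] := (outerEval 0).comp τ.symm
  have hφ : Function.Surjective φ := (outerEval_surjective 0).comp τ.symm.surjective
  have hP : RingHom.ker φ = Ideal.span {P} := by
    ext x
    have h := ker_outerEval (0 : k[X])
    rw [C_0, sub_zero] at h
    have h' : x ∈ RingHom.ker φ ↔ τ.symm x ∈ RingHom.ker (outerEval (0 : k[X])) := Iff.rfl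
    rw [h', h, Ideal.mem_span_singleton, Ideal.mem_span_singleton, ← hτX,
      ← map_dvd_iff τ, AlgEquiv.apply_symm_apply]
  have h0 : 0 < P.natDegree := by omega
  have hl := (natDegree_algHom_C_X_eq hφ hP h0).2
  have hsum (i : ℕ) (hi : P.coeff i ≠ 0) : (P.coeff i).natDegree + v.natDegree * i ≤ n := by
    have := hcoeff i
    rwa [comp_C_mul_X_coeff, natDegree_mul hi (pow_ne_zero _ hv0), natDegree_pow,
      mul_comm i] at this
  have hn : n = v.natDegree * P.natDegree := by
    apply le_antisymm
    · have := le_natDegree_of_ne_zero hmn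
      rw [comp_C_mul_X_coeff, ← hdegP] at this
      refine this.trans (natDegree_mul_le.trans ?_)
      rw [natDegree_pow, coeff_natDegree, hl, zero_add, mul_comm]
    · have := hsum P.natDegree
        (by rw [coeff_natDegree, leadingCoeff_ne_zero]; rintro rfl; simp at h0)
      omega
  rw [hn] at hsum
  have h1 : P.natDegree = 1 := by
    by_contra hP1
    have h2 : 2 ≤ P.natDegree := by omega
    obtain ⟨a₁, ha₁⟩ := natDegree_eq_zero.mp (natDegree_section_eq_zero hv h2 hl hsum h₁)
    obtain ⟨a₂, ha₂⟩ := natDegree_eq_zero.mp (natDegree_section_eq_zero hv h2 hl hsum h₂)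
    rw [algHom_comp_eq_of_section_const ha₁.symm] at h₁
    rw [algHom_comp_eq_of_section_const ha₂.symm] at h₂
    have key {p q : k[X]} (h : p.comp q = X) : p.natDegree = 1 := by
      have := congrArg natDegree h
      rw [natDegree_comp, natDegree_X] at this
      exact Nat.eq_one_of_mul_eq_one_right this
    refine hP1 (natDegree_eq_one_of_eval hφ hP h0 hv (a₁ := a₁) (a₂ := a₂) ?_ (key h₁) (key h₂))
    rintro rfl
    apply hne
    obtain ⟨r, hr, s, hL⟩ := natDegree_eq_one.mp (key h₁)
    rw [← hL] at h₁ h₂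
    have hb : χ₁ (C X) = χ₂ (C X) := by
      have := h₁.trans h₂.symm
      simpa [hr] using this
    refine Polynomial.algHom_ext' (Polynomial.algHom_ext hb) (by rw [← ha₁, ← ha₂])
  obtain ⟨r, hr, s, hL⟩ := natDegree_eq_one.mp h1
  have hlr : P.leadingCoeff = r := by rw [leadingCoeff, h1, ← hL]; simp
  rw [hlr] at hl
  have hr' := eq_C_of_natDegree_eq_zero hl
  refine ⟨r.coeff 0, s, fun h => hr (by rw [hr', h, C_0]), ?_, ?_⟩
  · by_cases hs : s = 0
    · simp [hs]
    · have h0s : P.coeff 0 = s := by rw [← hL]; simp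
      have := hsum 0 (by rwa [h0s])
      rw [h0s, h1] at this
      exact (degree_le_of_natDegree_le (by omega)).trans (degree_eq_natDegree hv0).ge
  · rw [← hr', ← hL]
    simp [mul_assoc]

variable (k) in
/-- The equivalence `k[X][X] ≃ k[X₀, X₁]` sending the outer variable to `X₀`. -/
noncomputable def outerEquiv : k[X][X] ≃ₐ[k] MvPolynomial (Fin 2) k :=
  (Bivariate.equivMvPolynomial k).trans (MvPolynomial.renameEquiv k (Equiv.swap 0 1))

theorem outerEquiv_X : outerEquiv k X = MvPolynomial.X 0 := by
  simp [outerEquiv]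

theorem outerEquiv_C (q : k[X]) : outerEquiv k (C q) = aeval (MvPolynomial.X 1) q := by
  have : ((outerEquiv k).toAlgHom.comp (Polynomial.CAlgHom : k[X] →ₐ[k] k[X][X])) =
      aeval (MvPolynomial.X 1) := by
    ext; simp [CAlgHom, outerEquiv]
  exact DFunLike.congr_fun this q

theorem coeff_coeff_outerEquiv_symm (F : MvPolynomial (Fin 2) k) (i j : ℕ) :
    (((outerEquiv k).symm F).coeff i).coeff j =
      F.coeff (Finsupp.single 0 i + Finsupp.single 1 j) := by
  induction F using MvPolynomial.induction_on' with
  | add p q hp hq => simp [hp, hq]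
  | monomial d a =>
    have h : (outerEquiv k).symm (MvPolynomial.monomial d a) =
        monomial (d 0) (monomial (d 1) a) := by
      rw [AlgEquiv.symm_apply_eq, ← C_mul_X_pow_eq_monomial, map_mul, map_pow, outerEquiv_C,
        outerEquiv_X, aeval_monomial, MvPolynomial.monomial_eq, Finsupp.prod_fintype _ _ (by simp)]
      simp [MvPolynomial.algebraMap_eq]
      ring
    have hd : d = Finsupp.single 0 i + Finsupp.single 1 j ↔ d 0 = i ∧ d 1 = j := by
      constructor
      · rintro rfl
        simp
      · rintro ⟨rfl, rfl⟩
        ext x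
        fin_cases x <;> simp
    rw [h, MvPolynomial.coeff_monomial, coeff_monomial]
    by_cases h0 : d 0 = i <;> by_cases h1 : d 1 = j <;> simp [hd, h0, h1, coeff_monomial]

theorem exists_section_of_mem_GammaAlg {k : Type} [Field k] {F : MvPolynomial (Fin 2) k}
    {p : Ideal (MvPolynomial (Fin 2) k)} (hp : p ∈ GammaAlg k F) :
    ∃ χ : MvPolynomial (Fin 2) k →ₐ[k] k[X], χ F = X ∧ RingHom.ker χ = p := by
  let θ : k[X] →ₐ[k] MvPolynomial (Fin 2) k ⧸ p := (Ideal.Quotient.mkₐ k p).comp (aeval F)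
  let e := AlgEquiv.ofBijective θ hp.2
  refine ⟨e.symm.toAlgHom.comp (Ideal.Quotient.mkₐ k p), ?_, ?_⟩
  · change e.symm (Ideal.Quotient.mk p F) = X
    rw [AlgEquiv.symm_apply_eq]
    change _ = Ideal.Quotient.mk p (aeval F X)
    rw [aeval_X]
  · ext x
    rw [RingHom.mem_ker, ← Ideal.Quotient.eq_zero_iff_mem]
    exact map_eq_zero_iff e.symm e.symm.injective

end Polynomial

/-- Over an algebraically closed field, if `F` is rectangular w.r.t. `(X,Y)`,
`|Γ_alg(F,A)| ≥ 2`, and `F` is a variable of `A' = k[X·v(Y), Y]` for some nonconstant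
`v(Y)`, then `F = c·X·v(Y) + w(Y)` with `c ≠ 0` and `deg w ≤ deg v`. -/
theorem stmt9 (k : Type) [Field k] [IsAlgClosed k]
    (F : MvPolynomial (Fin 2) k) (m n : ℕ) (hm : 1 ≤ m) (hn : 1 ≤ n)
    (hmem : MvPolynomial.coeff (Finsupp.single 0 m + Finsupp.single 1 n) F ≠ 0)
    (hsupp : ∀ d ∈ F.support, d 0 ≤ m ∧ d 1 ≤ n)
    (hΓ : ∃ p q, p ∈ GammaAlg k F ∧ q ∈ GammaAlg k F ∧ p ≠ q)
    (v : Polynomial k) (hv : 0 < v.natDegree)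
    (hvar : ∃ G ∈ Algebra.adjoin k
        ({X 0 * Polynomial.aeval (X 1 : MvPolynomial (Fin 2) k) v, X 1} :
          Set (MvPolynomial (Fin 2) k)),
      Algebra.adjoin k ({F, G} : Set (MvPolynomial (Fin 2) k))
        = Algebra.adjoin k
            ({X 0 * Polynomial.aeval (X 1 : MvPolynomial (Fin 2) k) v, X 1} :
              Set (MvPolynomial (Fin 2) k))) :
    ∃ (c : k) (w : Polynomial k), c ≠ 0 ∧ w.degree ≤ v.degree ∧
      F = C c * (X 0 * Polynomial.aeval (X 1 : MvPolynomial (Fin 2) k) v)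
          + Polynomial.aeval (X 1 : MvPolynomial (Fin 2) k) w := by
  obtain ⟨p, q, hp, hq, hpq⟩ := hΓ
  obtain ⟨χ₁, h₁, hk₁⟩ := Polynomial.exists_section_of_mem_GammaAlg hp
  obtain ⟨χ₂, h₂, hk₂⟩ := Polynomial.exists_section_of_mem_GammaAlg hq
  have hv0 : v ≠ 0 := by rintro rfl; simp at hv
  let E := Polynomial.outerEquiv k
  let σ : Polynomial (Polynomial k) →ₐ[k] Polynomial (Polynomial k) :=
    Polynomial.outerCompAlgHom v
  have hσ : Function.Injective σ := Polynomial.outerCompAlgHom_injective hv0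
  have hσX : E (σ Polynomial.X) = X 0 * Polynomial.aeval (X 1 : MvPolynomial (Fin 2) k) v := by
    simp only [σ, Polynomial.outerCompAlgHom_apply, Polynomial.X_comp, map_mul, E, Polynomial.outerEquiv_X,
      Polynomial.outerEquiv_C, mul_comm]
  have hσY : E (σ (Polynomial.C Polynomial.X)) = X 1 := by
    simp only [σ, Polynomial.outerCompAlgHom_apply, Polynomial.C_comp, E, Polynomial.outerEquiv_C, Polynomial.aeval_X]
  let f : Polynomial (Polynomial k) →ₐ[k] MvPolynomial (Fin 2) k := E.toAlgHom.comp σ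
  have hf : Function.Injective f := E.injective.comp hσ
  have hmap (x y : Polynomial (Polynomial k)) :
      (Algebra.adjoin k {x, y}).map f = Algebra.adjoin k {f x, f y} := by
    rw [AlgHom.map_adjoin, Set.image_pair]
  have hA : Algebra.adjoin k
      ({X 0 * Polynomial.aeval (X 1 : MvPolynomial (Fin 2) k) v, X 1} :
        Set (MvPolynomial (Fin 2) k)) = f.range := by
    rw [← hσX, ← hσY, ← Algebra.map_top, ← Polynomial.adjoin_X_C_X, hmap]
    rfl
  rw [hA] at hvar
  obtain ⟨G, ⟨Q, rfl⟩, hFG⟩ := hvar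
  obtain ⟨P, rfl⟩ : F ∈ f.range := hFG ▸ Algebra.subset_adjoin (by simp)
  have htop : Algebra.adjoin k {P, Q} = ⊤ := by
    apply Subalgebra.map_injective hf
    rw [hmap, Algebra.map_top]
    exact hFG
  rw [← Polynomial.range_aevalAeval, AlgHom.range_eq_top] at htop
  have hEs : E.symm (f P) = P.comp (Polynomial.C v * Polynomial.X) := by
    rw [AlgEquiv.symm_apply_eq]
    exact congrArg E (Polynomial.outerCompAlgHom_apply v P)
  have hc (i j : ℕ) : ((P.comp (Polynomial.C v * Polynomial.X)).coeff i).coeff j =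
      (f P).coeff (Finsupp.single 0 i + Finsupp.single 1 j) := by
    rw [← hEs]
    exact Polynomial.coeff_coeff_outerEquiv_symm _ i j
  have hzero (i j : ℕ) (hij : m < i ∨ n < j) :
      ((P.comp (Polynomial.C v * Polynomial.X)).coeff i).coeff j = 0 := by
    rw [hc]
    by_contra h
    have := hsupp _ (mem_support_iff.mpr h)
    simp at this
    omega
  obtain ⟨c, w, hc0, hw, hP⟩ := Polynomial.eq_linear_of_two_sections htop hv hm
    (Polynomial.natDegree_le_iff_coeff_eq_zero.mpr fun i hi => by
      ext j
      rw [hzero i j (Or.inl hi), Polynomial.coeff_zero])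
    (fun i => Polynomial.natDegree_le_iff_coeff_eq_zero.mpr fun j hj => hzero i j (Or.inr hj))
    (by rw [hc]; exact hmem)
    (χ₁ := χ₁.comp E.toAlgHom) (χ₂ := χ₂.comp E.toAlgHom)
    (by rw [← hEs]; simpa using h₁) (by rw [← hEs]; simpa using h₂)
    (by
      intro h
      apply hpq
      rw [← hk₁, ← hk₂]
      congr 1
      ext x : 1
      exact (AlgHom.cancel_right E.surjective).mp h ▸ rfl)
  refine ⟨c, w, hc0, hw, ?_⟩
  change f P = _
  rw [← E.apply_symm_apply (f P), hEs, hP]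
  simp only [E, map_add, map_mul, Polynomial.outerEquiv_X, Polynomial.outerEquiv_C, Polynomial.aeval_C,
    algebraMap_eq]
  ring
end

section
/- Let L/K be a function field in one variable and let V(L/K) be the set of valuation rings R with K ⊆ R ⊆ L, Frac(R) = L and R ≠ L. For g ∈ L*, the principal divisor div(g) = Σ_{R ∈ V(L/K)} v_R(g)·R has degree zero, where the degree of a divisor Σ n_R · R is Σ n_R · [R/m_R : K]. Consequently, for any g ∈ L*, Σ_{R} v_R(g)·[R/m_R : K] = 0. -/
/-- The order of `x` at the valuation ring `R`, as a natural number: the supremum of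
the `n` such that `x` lies in the `n`-th power of the maximal ideal of `R`
(junk value `0` if `x ∉ R`). For a discrete valuation ring this is the usual valuation
of an element of `R`. -/
noncomputable def natOrd {L : Type} [Field L] (R : ValuationSubring L) (x : L) : ℕ :=
  sSup {n : ℕ | ∃ y : R, (y : L) = x ∧ y ∈ (IsLocalRing.maximalIdeal R) ^ n}

/-- The ℤ-valued order `v_R(x)` of `x ∈ L*` at a valuation ring `R` of `L`. -/
noncomputable def intOrd {L : Type} [Field L] (R : ValuationSubring L) (x : L) : ℤ :=
  (natOrd R x : ℤ) - (natOrd R x⁻¹ : ℤ)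

set_option synthInstance.maxHeartbeats 1000000 in
open Classical in
/-- The residue degree `[R/m_R : K]` of a valuation ring `R` of `L` over a subfield
`K ⊆ R` (junk value `0` if `K ⊄ R`). -/
noncomputable def resDeg {L : Type} [Field L] (K : Subfield L) (R : ValuationSubring L) : ℕ :=
  if h : (K : Set L) ⊆ (R : Set L) then
    @Module.finrank K (R ⧸ IsLocalRing.maximalIdeal R) _ _
      (Module.compHom _ ((Ideal.Quotient.mk (IsLocalRing.maximalIdeal R)).comp
        { toFun := fun x => (⟨(x : L), h x.2⟩ : R),
          map_one' := rfl, map_mul' := fun _ _ => rfl,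
          map_zero' := rfl, map_add' := fun _ _ => rfl }))
  else 0

section FiniteDimension
open Polynomial

variable {K L : Type*} [Field K] [Field L] [Algebra K L]

theorem finiteDimensional_adjoin_of_transcendental
    (hfg : ∃ s : Finset L, IntermediateField.adjoin K (s : Set L) = ⊤)
    {x : L} (hx : Transcendental K x)
    (halg : Algebra.IsAlgebraic (IntermediateField.adjoin K ({x} : Set L)) L)
    {y : L} (hy : Transcendental K y) :
    FiniteDimensional (IntermediateField.adjoin K ({y} : Set L)) L := by
  have hx' : IsTranscendenceBasis K (fun _ : Unit => x) := by
    refine isTranscendenceBasis_iff_algebraicIndependent_isAlgebraic.2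
      ⟨(algebraicIndependent_unique_type_iff).2 hx, ?_⟩
    rw [Set.range_const]
    open scoped IntermediateField.algebraAdjoinAdjoin in
    exact Algebra.IsAlgebraic.trans (Algebra.adjoin K {x})
      (IntermediateField.adjoin K ({x} : Set L)) L
  have hy' : IsTranscendenceBasis K (fun _ : Unit => y) := by
    refine AlgebraicIndependent.isTranscendenceBasis_of_lift_trdeg_le_of_finite
      ((algebraicIndependent_unique_type_iff).2 hy) ?_
    rw [← hx'.lift_cardinalMk_eq_trdeg]
  have halg' := hy'.isAlgebraic_field
  rw [Set.range_const] at halg'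
  obtain ⟨s, hs⟩ := hfg
  have h1 : FiniteDimensional (IntermediateField.adjoin K ({y} : Set L))
      (IntermediateField.adjoin (IntermediateField.adjoin K ({y} : Set L)) (s : Set L)) :=
    IntermediateField.finiteDimensional_adjoin fun z _ => (halg'.isAlgebraic z).isIntegral
  have h2 : IntermediateField.adjoin (IntermediateField.adjoin K ({y} : Set L)) (s : Set L)
      = ⊤ := by
    rw [eq_top_iff]
    intro z _
    have : z ∈ IntermediateField.adjoin K (s : Set L) := hs ▸ IntermediateField.mem_top
    have hle : IntermediateField.adjoin K (s : Set L) ≤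
        (IntermediateField.adjoin (IntermediateField.adjoin K ({y} : Set L))
          (s : Set L)).restrictScalars K :=
      IntermediateField.adjoin_le_iff.2 (IntermediateField.subset_adjoin _ _)
    exact hle this
  rw [h2] at h1
  exact Module.Finite.equiv IntermediateField.topEquiv.toLinearEquiv

section KrullAkizuki

variable {N : Type*} [AddCommGroup N] [Module K N] {y : L} {M : Submodule K L}

theorem aeval_mul_mem (hM : ∀ m ∈ M, y * m ∈ M) (p : K[X]) {m : L} (hm : m ∈ M) :
    aeval y p * m ∈ M := by
  induction p using Polynomial.induction_on' with
  | add p q hp hq => simpa [add_mul] using M.add_mem hp hq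
  | monomial k a =>
    have : y ^ k * m ∈ M := by
      induction k with
      | zero => simpa
      | succ k ih => simpa [pow_succ', mul_assoc] using hM _ ih
    simpa [aeval_monomial, mul_assoc, ← Algebra.smul_def] using M.smul_mem a this

theorem X_pow_dvd_of_sum_aeval_mul_eq_zero (hy : y ≠ 0) (hM : ∀ m ∈ M, y * m ∈ M)
    {φ : M →ₗ[K] N} (hφ : ∀ m : M, φ ⟨y * m, hM m m.2⟩ = 0)
    {ι : Type*} [Fintype ι] {b : ι → M}
    (hb : LinearIndependent K (φ ∘ b)) (k : ℕ) (p : ι → K[X])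
    (h : ∑ i, aeval y (p i) * (b i : L) = 0) (i : ι) : X ^ k ∣ p i := by
  induction k generalizing p with
  | zero => simp
  | succ k ih =>
    have hsplit (i : ι) : aeval y (p i) * (b i : L) =
        (p i).coeff 0 • (b i : L) + y * (aeval y (p i).divX * (b i : L)) := by
      conv_lhs => rw [← divX_mul_X_add (p i)]
      simp [Algebra.smul_def]
      ring
    let m : M := ⟨∑ i, aeval y (p i).divX * (b i : L),
      M.sum_mem fun i _ => aeval_mul_mem hM _ (b i).2⟩
    have hsum : ∑ i, (p i).coeff 0 • b i + ⟨y * m, hM m m.2⟩ = (0 : M) := by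
      ext
      simp only [hsplit, Finset.sum_add_distrib, ← Finset.mul_sum] at h
      simpa [m] using h
    have hcoeff : ∀ i, (p i).coeff 0 = 0 := by
      refine Fintype.linearIndependent_iff.1 hb _ ?_
      simpa [hφ] using congrArg φ hsum
    have hdiv : ∑ i, aeval y (p i).divX * (b i : L) = 0 := by
      simpa [hcoeff, Subtype.ext_iff, hy, m] using hsum
    have := ih (fun i => (p i).divX) hdiv
    rw [← divX_mul_X_add (p i), hcoeff i, pow_succ]
    simpa using mul_dvd_mul_right this X

theorem linearIndependent_adjoin_of_linearIndependent (hy : y ≠ 0) (hM : ∀ m ∈ M, y * m ∈ M)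
    {φ : M →ₗ[K] N} (hφ : ∀ m : M, φ ⟨y * m, hM m m.2⟩ = 0)
    {ι : Type*} [Fintype ι] {b : ι → M}
    (hb : LinearIndependent K (φ ∘ b)) :
    LinearIndependent (IntermediateField.adjoin K ({y} : Set L)) (fun i => (b i : L)) := by
  open scoped IntermediateField.algebraAdjoinAdjoin in
  rw [← LinearIndependent.iff_fractionRing (Algebra.adjoin K {y})]
  refine Fintype.linearIndependent_iff.2 fun r hr i => ?_
  have hp (i : ι) : ∃ p : K[X], aeval y p = (r i : L) := by
    have : (r i : L) ∈ (aeval (R := K) y).range := by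
      rw [← Algebra.adjoin_singleton_eq_range_aeval]
      exact (r i).2
    exact this
  choose p hp using hp
  have h : ∑ i, aeval y (p i) * (b i : L) = 0 := by simpa [hp, Subalgebra.smul_def] using hr
  have hdvd := fun k => X_pow_dvd_of_sum_aeval_mul_eq_zero hy hM hφ hb k p h i
  have : p i = 0 := by
    by_contra h0
    have := natDegree_le_of_dvd (hdvd ((p i).natDegree + 1)) h0
    simp at this
  ext
  simp [← hp, this]

theorem finite_and_finrank_le_of_surjective (hy : y ≠ 0) (hM : ∀ m ∈ M, y * m ∈ M)
    {φ : M →ₗ[K] N} (hφ : ∀ m : M, φ ⟨y * m, hM m m.2⟩ = 0)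
    [FiniteDimensional (IntermediateField.adjoin K ({y} : Set L)) L]
    (hsurj : Function.Surjective φ) : Module.Finite K N ∧
      Module.finrank K N ≤ Module.finrank (IntermediateField.adjoin K ({y} : Set L)) L := by
  have hrank : Module.rank K N ≤
      (Module.finrank (IntermediateField.adjoin K ({y} : Set L)) L : ℕ) := by
    refine rank_le fun s hs => ?_
    have := linearIndependent_adjoin_of_linearIndependent hy hM hφ
      (b := fun i : s => Function.surjInv hsurj i)
      (by convert hs using 1; ext i; exact Function.surjInv_eq hsurj _)
    simpa using this.fintype_card_le_finrank
  have hfin : Module.Finite K N :=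
    Module.rank_lt_aleph0_iff.1 (hrank.trans_lt Cardinal.natCast_lt_aleph0)
  exact ⟨hfin, Module.finrank_le_of_rank_le hrank⟩

end KrullAkizuki
end FiniteDimension

/-- The places of `L / K`: the nontrivial valuation rings of `L` containing `K`. -/
abbrev Place (K L : Type*) [Field K] [Field L] [Algebra K L] : Type _ :=
  {R : ValuationSubring L //
    (((algebraMap K L).fieldRange : Subfield L) : Set L) ⊆ (R : Set L) ∧ R ≠ ⊤}

namespace Place

variable {K L : Type*} [Field K] [Field L] [Algebra K L]

theorem algebraMap_mem (P : Place K L) (a : K) : algebraMap K L a ∈ P.1 := P.2.1 ⟨a, rfl⟩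

instance (P : Place K L) : Algebra K P.1 :=
  ((algebraMap K L).codRestrict P.1 P.algebraMap_mem).toAlgebra

instance (P : Place K L) : IsScalarTower K P.1 L := .of_algebraMap_eq fun _ => rfl

variable (P : Place K L)

theorem smul_mem (a : K) {z : L} (hz : z ∈ P.1) : a • z ∈ P.1 := by
  rw [Algebra.smul_def]
  exact mul_mem (P.algebraMap_mem a) hz

theorem mem_of_isIntegral {z : L} (hz : IsIntegral P.1 z) : z ∈ P.1 := by
  obtain ⟨w, rfl⟩ := IsIntegrallyClosed.isIntegral_iff.1 hz
  exact w.2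

theorem mem_of_isAlgebraic {z : L} (hz : IsAlgebraic K z) : z ∈ P.1 :=
  P.mem_of_isIntegral (hz.isIntegral.tower_top)

theorem valuation_eq_one_of_isAlgebraic {z : L} (hz : IsAlgebraic K z) (h0 : z ≠ 0) :
    P.1.valuation z = 1 := by
  have h1 := (P.1.valuation_le_one_iff z).2 (P.mem_of_isAlgebraic hz)
  have h2 := (P.1.valuation_le_one_iff z⁻¹).2 (P.mem_of_isAlgebraic hz.inv)
  rw [map_inv₀, inv_le_one₀ ((Valuation.pos_iff _).2 h0)] at h2
  exact le_antisymm h1 h2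

theorem transcendental_of_valuation_lt_one {z : L} (h : P.1.valuation z < 1) (h0 : z ≠ 0) :
    Transcendental K z := fun hz => h.ne (P.valuation_eq_one_of_isAlgebraic hz h0)

/-- The reduction modulo an ideal of a place of a linear map with values in that place. -/
def reduce {V : Type*} [AddCommGroup V] [Module K V] (f : V →ₗ[K] L) (h : ∀ v, f v ∈ P.1)
    (I : Ideal P.1) : V →ₗ[K] P.1 ⧸ I where
  toFun v := Ideal.Quotient.mk I ⟨f v, h v⟩
  map_add' v w := by
    rw [← map_add]
    congr 1
    ext
    simp
  map_smul' a v := by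
    rw [RingHom.id_apply, ← Ideal.Quotient.mkₐ_eq_mk K, ← map_smul]
    congr 1
    ext
    simp only [map_smul, Algebra.smul_def]
    rfl

theorem reduce_eq_zero_iff {V : Type*} [AddCommGroup V] [Module K V] (f : V →ₗ[K] L)
    (h : ∀ v, f v ∈ P.1) (a : P.1) (v : V) :
    P.reduce f h (Ideal.span {a}) v = 0 ↔ P.1.valuation (f v) ≤ P.1.valuation a := by
  rw [ValuationSubring.valuation_le_iff]
  change Ideal.Quotient.mk _ _ = 0 ↔ _
  rw [Ideal.Quotient.eq_zero_iff_mem, Ideal.mem_span_singleton']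
  simp [Subtype.ext_iff]

/-- The elements which are regular at all places in `S`. -/
def regular (S : Finset (Place K L)) : Submodule K L where
  carrier := {z | ∀ P ∈ S, z ∈ P.1}
  add_mem' hz hw P hP := add_mem (hz P hP) (hw P hP)
  zero_mem' P _ := P.1.zero_mem
  smul_mem' a _ hz P hP := P.smul_mem a (hz P hP)

theorem mem_regular {S : Finset (Place K L)} {z : L} : z ∈ regular S ↔ ∀ P ∈ S, z ∈ P.1 :=
  Iff.rfl

theorem mem_regular_singleton {z : L} : z ∈ regular {P} ↔ z ∈ P.1 := by simp [mem_regular]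

theorem finite_quotient_span (hfin : ∀ y : L, Transcendental K y →
    FiniteDimensional (IntermediateField.adjoin K ({y} : Set L)) L)
    (a : P.1) (ha : a ≠ 0) :
    Module.Finite K (P.1 ⧸ Ideal.span {a}) := by
  by_cases hu : IsUnit a
  · rw [Ideal.span_singleton_eq_top.2 hu]
    have : Subsingleton (P.1 ⧸ (⊤ : Ideal P.1)) := Ideal.Quotient.subsingleton_iff.2 rfl
    infer_instance
  have ha' : (a : L) ≠ 0 := by simpa using ha
  have hv : P.1.valuation a < 1 :=
    (P.1.valuation_lt_one_or_eq_one a).resolve_right fun h =>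
      hu ((P.1.valuation_eq_one_iff a).2 h)
  have := hfin _ (P.transcendental_of_valuation_lt_one hv ha')
  refine (finite_and_finrank_le_of_surjective (y := (a : L)) (M := regular {P}) ha'
    (fun m hm => P.mem_regular_singleton.2 (mul_mem a.2 (P.mem_regular_singleton.1 hm)))
    (φ := P.reduce (regular {P}).subtype (fun v => P.mem_regular_singleton.1 v.2)
      (Ideal.span {a})) ?_ ?_).1
  · intro m
    refine (P.reduce_eq_zero_iff _ _ _ _).2 ?_
    simpa using mul_le_of_le_one_right'
      ((P.1.valuation_le_one_iff _).2 (P.mem_regular_singleton.1 m.2))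
  · intro z
    obtain ⟨w, rfl⟩ := Ideal.Quotient.mk_surjective z
    exact ⟨⟨w, P.mem_regular_singleton.2 w.2⟩, rfl⟩

theorem not_isField : ¬ IsField P.1 := by
  intro h
  refine P.2.2 (eq_top_iff.2 fun z _ => ?_)
  rcases P.1.mem_or_inv_mem z with hz | hz
  · exact hz
  by_cases h0 : z = 0
  · simp [h0]
  obtain ⟨w, hw⟩ := h.mul_inv_cancel (a := ⟨z⁻¹, hz⟩) (by simpa [Subtype.ext_iff] using h0)
  have : z⁻¹ * w = 1 := congrArg Subtype.val hw
  rw [inv_mul_eq_one₀ h0] at this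
  exact this ▸ w.2

theorem isDiscreteValuationRing (hfin : ∀ y : L, Transcendental K y →
    FiniteDimensional (IntermediateField.adjoin K ({y} : Set L)) L) :
    IsDiscreteValuationRing P.1 := by
  have : IsNoetherianRing P.1 := by
    refine (isNoetherianRing_iff_ideal_fg _).2 fun I => ?_
    by_cases hI : I = ⊥
    · exact hI ▸ Submodule.fg_bot
    obtain ⟨a, haI, ha⟩ := Submodule.exists_mem_ne_zero_of_ne_bot hI
    have := P.finite_quotient_span hfin a ha
    have : IsNoetherian P.1 (P.1 ⧸ Ideal.span {a}) := isNoetherian_of_tower K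
      (inferInstance : IsNoetherian K (P.1 ⧸ Ideal.span {a}))
    refine Submodule.fg_of_fg_map_of_fg_inf_ker (Ideal.span {a}).mkQ
      (IsNoetherian.noetherian _) ?_
    rw [Submodule.ker_mkQ, inf_eq_right.2]
    · exact ⟨{a}, by simp⟩
    · rwa [Ideal.span_singleton_le_iff_mem]
  have h := (IsDiscreteValuationRing.TFAE P.1 P.not_isField).out 0 1
  exact h.2 inferInstance

/-- The dimension of the residue ring `P / a P`. -/
noncomputable def codim (a : P.1) : ℕ := Module.finrank K (P.1 ⧸ Ideal.span {a})

theorem codim_of_isUnit {a : P.1} (ha : IsUnit a) : P.codim a = 0 := by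
  rw [codim, Ideal.span_singleton_eq_top.2 ha]
  have : Subsingleton (P.1 ⧸ (⊤ : Ideal P.1)) := Ideal.Quotient.subsingleton_iff.2 rfl
  exact Module.finrank_zero_of_subsingleton

theorem codim_pos (hfin : ∀ y : L, Transcendental K y →
    FiniteDimensional (IntermediateField.adjoin K ({y} : Set L)) L)
    {a : P.1} (ha : a ≠ 0) (hu : ¬ IsUnit a) : 0 < P.codim a := by
  have := P.finite_quotient_span hfin a ha
  have : Nontrivial (P.1 ⧸ Ideal.span {a}) :=
    Ideal.Quotient.nontrivial_iff.2 (mt Ideal.span_singleton_eq_top.1 hu)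
  exact Module.finrank_pos

theorem codim_mul (hfin : ∀ y : L, Transcendental K y →
    FiniteDimensional (IntermediateField.adjoin K ({y} : Set L)) L)
    {a b : P.1} (ha : a ≠ 0) (hb : b ≠ 0) :
    P.codim (a * b) = P.codim a + P.codim b := by
  have := P.finite_quotient_span hfin (a * b) (mul_ne_zero ha hb)
  have hle : Ideal.span {a * b} ≤ Submodule.comap LinearMap.id (Ideal.span {a}) := by
    rw [Ideal.span_singleton_le_iff_mem]
    exact Ideal.mem_span_singleton.2 (dvd_mul_right a b)
  have hle' : Ideal.span {b} ≤ Submodule.comap (LinearMap.mulLeft P.1 a) (Ideal.span {a * b}) := by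
    rw [Ideal.span_singleton_le_iff_mem]
    exact Ideal.mem_span_singleton.2 dvd_rfl
  let f := ((Ideal.span {a * b}).mapQ (Ideal.span {a}) LinearMap.id hle).restrictScalars K
  let g := ((Ideal.span {b}).mapQ (Ideal.span {a * b}) (LinearMap.mulLeft P.1 a)
    hle').restrictScalars K
  have hf : Function.Surjective f := by
    intro z
    obtain ⟨w, rfl⟩ := Submodule.Quotient.mk_surjective _ z
    exact ⟨Submodule.Quotient.mk w, rfl⟩
  have hg : Function.Injective g := by
    rw [← LinearMap.ker_eq_bot, LinearMap.ker_eq_bot']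
    intro z hz
    obtain ⟨w, rfl⟩ := Submodule.Quotient.mk_surjective _ z
    have hz : Submodule.Quotient.mk (p := Ideal.span {a * b}) (a * w) = 0 := hz
    rw [Submodule.Quotient.mk_eq_zero, Ideal.mem_span_singleton] at hz ⊢
    exact (mul_dvd_mul_iff_left ha).1 hz
  have hfg : LinearMap.range g = LinearMap.ker f := by
    ext z
    obtain ⟨w, rfl⟩ := Submodule.Quotient.mk_surjective _ z
    constructor
    · rintro ⟨u, hu⟩
      obtain ⟨u, rfl⟩ := Submodule.Quotient.mk_surjective _ u
      rw [← hu]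
      change Submodule.Quotient.mk (p := Ideal.span {a}) (a * u) = 0
      rw [Submodule.Quotient.mk_eq_zero, Ideal.mem_span_singleton]
      exact dvd_mul_right _ _
    · intro h
      have h : Submodule.Quotient.mk (p := Ideal.span {a}) w = 0 := h
      rw [Submodule.Quotient.mk_eq_zero, Ideal.mem_span_singleton] at h
      obtain ⟨u, rfl⟩ := h
      exact ⟨Submodule.Quotient.mk u, rfl⟩
  have h := LinearMap.finrank_range_add_finrank_ker f
  rw [← hfg, LinearMap.finrank_range_of_inj hg, LinearMap.range_eq_top.2 hf, finrank_top] at h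
  exact h.symm

theorem codim_pow (hfin : ∀ y : L, Transcendental K y →
    FiniteDimensional (IntermediateField.adjoin K ({y} : Set L)) L)
    {a : P.1} (ha : a ≠ 0) (k : ℕ) : P.codim (a ^ k) = k * P.codim a := by
  induction k with
  | zero => simp [codim_of_isUnit]
  | succ k ih => rw [pow_succ, P.codim_mul hfin (pow_ne_zero _ ha) ha, ih, add_one_mul]

end Place

namespace Place
open Filter

variable {K L : Type*} [Field K] [Field L] [Algebra K L]

theorem eventually_valuation_pow_le (hfin : ∀ y : L, Transcendental K y →
    FiniteDimensional (IntermediateField.adjoin K ({y} : Set L)) L) (P : Place K L) {a b : L}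
    (ha : P.1.valuation a < 1) (hb : b ≠ 0) :
    ∀ᶠ r : ℕ in atTop, P.1.valuation (a ^ r) ≤ P.1.valuation b := by
  have hpow (r : ℕ) : P.1.valuation (a ^ r) ≤ 1 := by
    rw [map_pow]
    exact pow_le_one' ha.le r
  rcases le_or_gt 1 (P.1.valuation b) with h1 | h1
  · exact .of_forall fun r => (hpow r).trans h1
  have := P.isDiscreteValuationRing hfin
  let a' : P.1 := ⟨a, P.1.mem_of_valuation_le_one _ ha.le⟩
  let b' : P.1 := ⟨b, P.1.mem_of_valuation_le_one _ h1.le⟩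
  have ha' : a' ∈ IsLocalRing.maximalIdeal P.1 := (P.1.valuation_lt_one_iff a').2 ha
  have hb' : ∃ n, b' ∉ IsLocalRing.maximalIdeal P.1 ^ n := by
    by_contra! h
    have h' : b' ∈ (⨅ n, IsLocalRing.maximalIdeal P.1 ^ n) := Ideal.mem_iInf.2 h
    rw [Ideal.iInf_pow_eq_bot_of_isDomain _ (Ideal.IsPrime.ne_top'), Ideal.mem_bot] at h'
    exact hb (congrArg Subtype.val h')
  obtain ⟨n, hn⟩ := hb'
  filter_upwards [eventually_ge_atTop n] with r hr
  by_contra! hlt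
  obtain ⟨c, hc⟩ := (P.1.valuation_le_iff b (a ^ r)).1 hlt.le
  refine hn (Ideal.pow_le_pow_right hr ?_)
  have : b' = c * a' ^ r := Subtype.ext hc.symm
  rw [this]
  exact Ideal.mul_mem_left _ _ (Ideal.pow_mem_pow ha' r)

theorem exists_one_lt_valuation_lt_one (hfin : ∀ y : L, Transcendental K y →
    FiniteDimensional (IntermediateField.adjoin K ({y} : Set L)) L) {P Q : Place K L}
    (hPQ : P ≠ Q) : ∃ w : L, 1 < P.1.valuation w ∧ Q.1.valuation w < 1 := by
  have key {P Q : Place K L} (hPQ : P ≠ Q) :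
      ∃ a : L, 1 < P.1.valuation a ∧ Q.1.valuation a ≤ 1 := by
    by_contra! h
    have := Q.isDiscreteValuationRing hfin
    refine hPQ (Subtype.ext (ValuationSubring.eq_of_le_of_ne_top Q.1 (fun z hz => ?_) P.2.2).symm)
    by_contra hz'
    exact (h z (not_le.1 (mt (P.1.valuation_le_one_iff z).1 hz'))).not_ge
      ((Q.1.valuation_le_one_iff z).2 hz)
  obtain ⟨a, ha, ha'⟩ := key hPQ
  obtain ⟨b, hb, hb'⟩ := key hPQ.symm
  have hb0 : b ≠ 0 := by
    rintro rfl
    simp at hb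
  refine ⟨a / b, ?_, ?_⟩
  · rw [map_div₀, one_lt_div₀ ((Valuation.pos_iff _).2 hb0)]
    exact hb'.trans_lt ha
  · rw [map_div₀, div_lt_one₀ ((Valuation.pos_iff _).2 hb0)]
    exact ha'.trans_lt hb

theorem valuation_one_add_pow {P : Place K L} {u : L} (hu : 1 < P.1.valuation u) {r : ℕ}
    (hr : r ≠ 0) : P.1.valuation (1 + u ^ r) = P.1.valuation u ^ r := by
  rw [Valuation.map_add_eq_of_lt_right, map_pow]
  rw [map_one, map_pow]
  exact one_lt_pow₀ hu hr

theorem valuation_one_add_pow_of_lt_one {P : Place K L} {u : L} (hu : P.1.valuation u < 1)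
    {r : ℕ} (hr : r ≠ 0) : P.1.valuation (1 + u ^ r) = 1 := by
  refine Valuation.map_one_add_of_lt _ ?_
  rw [map_pow]
  exact pow_lt_one₀ zero_le hu hr

theorem exists_one_lt_valuation_forall_lt_one (hfin : ∀ y : L, Transcendental K y →
    FiniteDimensional (IntermediateField.adjoin K ({y} : Set L)) L) (P : Place K L)
    (S : Finset (Place K L)) (hP : P ∉ S) :
    ∃ u : L, 1 < P.1.valuation u ∧ ∀ Q ∈ S, Q.1.valuation u < 1 := by
  classical
  induction S using Finset.induction_on with
  | empty =>
    obtain ⟨u, hu⟩ : ∃ u, u ∉ P.1 := by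
      by_contra! h
      exact P.2.2 (eq_top_iff.2 fun z _ => h z)
    exact ⟨u, not_le.1 (mt (P.1.valuation_le_one_iff u).1 hu), by simp⟩
  | insert Q S _ ih =>
    rw [Finset.mem_insert, not_or] at hP
    obtain ⟨u, hu, huS⟩ := ih hP.2
    obtain ⟨w, hw, hwQ⟩ := exists_one_lt_valuation_lt_one hfin hP.1
    have hu0 : u ≠ 0 := by
      rintro rfl
      simp at hu
    have hw0 : w ≠ 0 := by
      rintro rfl
      simp at hw
    have hev : ∀ᶠ r : ℕ in atTop, ∀ R ∈ S, R.1.valuation (u ^ r * w) < 1 := by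
      rw [eventually_all_finset]
      intro R hR
      filter_upwards [R.eventually_valuation_pow_le hfin (huS R hR)
        (mul_ne_zero hu0 (inv_ne_zero hw0))] with r hr
      rw [map_mul, map_inv₀, ← div_eq_mul_inv, le_div_iff₀ ((Valuation.pos_iff _).2 hw0),
        ← map_mul] at hr
      exact hr.trans_lt (huS R hR)
    obtain ⟨r, hr, hr1⟩ := (hev.and (eventually_ge_atTop 1)).exists
    have hr0 : r ≠ 0 := by lia
    rcases le_or_gt (Q.1.valuation u) 1 with hQ | hQ
    · refine ⟨u ^ r * w, ?_, ?_⟩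
      · rw [map_mul, map_pow]
        exact one_lt_mul_of_le_of_lt (one_lt_pow₀ hu hr0).le hw
      · rw [Finset.forall_mem_insert]
        refine ⟨?_, hr⟩
        rw [map_mul, map_pow]
        exact mul_lt_one_of_nonneg_of_lt_one_right (pow_le_one' hQ r) zero_le hwQ
    · have hval {R : Place K L} (hR : 1 < R.1.valuation u) :
          R.1.valuation (u ^ r * w / (1 + u ^ r)) = R.1.valuation w := by
        rw [map_div₀, map_mul, map_pow, valuation_one_add_pow hR hr0]
        exact mul_div_cancel_left₀ _ (pow_ne_zero _ ((Valuation.ne_zero_iff _).2 hu0))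
      refine ⟨u ^ r * w / (1 + u ^ r), (hval hu).symm ▸ hw, ?_⟩
      rw [Finset.forall_mem_insert]
      refine ⟨(hval hQ).symm ▸ hwQ, fun R hR => ?_⟩
      rw [map_div₀, valuation_one_add_pow_of_lt_one (huS R hR) hr0, div_one]
      exact hr R hR

theorem exists_valuation_sub_le_and_forall_le (hfin : ∀ y : L, Transcendental K y →
    FiniteDimensional (IntermediateField.adjoin K ({y} : Set L)) L) (P : Place K L)
    (S : Finset (Place K L)) (x : L) {y : L} (hy : y ≠ 0) :
    ∃ z : L, P.1.valuation (z - x) ≤ P.1.valuation y ∧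
      ∀ Q ∈ S, Q ≠ P → Q.1.valuation z ≤ Q.1.valuation y := by
  classical
  by_cases hx : x = 0
  · exact ⟨0, by simp [hx]⟩
  obtain ⟨u, hu, huS⟩ :=
    exists_one_lt_valuation_forall_lt_one hfin P (S.erase P) (Finset.notMem_erase P S)
  have hu' : P.1.valuation u⁻¹ < 1 := by
    rw [map_inv₀]
    exact inv_lt_one_of_one_lt₀ hu
  have hev : ∀ᶠ r : ℕ in atTop, ∀ R ∈ S.erase P, R.1.valuation (u ^ r) ≤ R.1.valuation (y / x) :=
    (eventually_all_finset _).2 fun R hR =>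
      R.eventually_valuation_pow_le hfin (huS R hR) (div_ne_zero hy hx)
  obtain ⟨r, ⟨hr, hrP⟩, hr1⟩ := ((hev.and (P.eventually_valuation_pow_le hfin hu'
    (div_ne_zero hy hx))).and (eventually_ge_atTop 1)).exists
  have hr0 : r ≠ 0 := by lia
  have h1 : 1 + u ^ r ≠ 0 := by
    rw [← Valuation.ne_zero_iff P.1.valuation, valuation_one_add_pow hu hr0]
    exact (pow_pos (zero_lt_one.trans hu) r).ne'
  refine ⟨u ^ r * x / (1 + u ^ r), ?_, fun R hR hRP => ?_⟩
  · have : u ^ r * x / (1 + u ^ r) - x = -(x / (1 + u ^ r)) := by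
      field_simp
      ring
    rw [this, Valuation.map_neg, map_div₀, valuation_one_add_pow hu hr0]
    rw [map_div₀, le_div_iff₀ ((Valuation.pos_iff _).2 hx), map_pow, map_inv₀, inv_pow] at hrP
    rwa [div_eq_inv_mul]
  · have hR' := Finset.mem_erase.2 ⟨hRP, hR⟩
    have := hr R hR'
    rw [map_div₀, le_div_iff₀ ((Valuation.pos_iff _).2 hx), ← map_mul] at this
    rwa [map_div₀, valuation_one_add_pow_of_lt_one (huS R hR') hr0, div_one]

/-- Weak approximation for finitely many places. -/
theorem exists_forall_valuation_sub_le (hfin : ∀ y : L, Transcendental K y →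
    FiniteDimensional (IntermediateField.adjoin K ({y} : Set L)) L)
    (S : Finset (Place K L)) (x : Place K L → L) {y : L} (hy : y ≠ 0) :
    ∃ z : L, ∀ P ∈ S, P.1.valuation (z - x P) ≤ P.1.valuation y := by
  classical
  choose z hz hzS using fun P => exists_valuation_sub_le_and_forall_le hfin P S (x P) hy
  refine ⟨∑ P ∈ S, z P, fun P hP => ?_⟩
  rw [← Finset.add_sum_erase S z hP, add_sub_right_comm]
  refine Valuation.map_add_le _ (hz P) (Valuation.map_sum_le _ fun Q hQ => ?_)
  rw [Finset.mem_erase] at hQ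
  exact hzS Q P hP hQ.1.symm

open Classical in
/-- The contribution of a place to the degree of the divisor of zeros of an element. -/
noncomputable def zeroDegree (P : Place K L) (z : L) : ℕ :=
  if h : z ∈ P.1 then P.codim ⟨z, h⟩ else 0

theorem zeroDegree_of_mem (P : Place K L) {z : L} (h : z ∈ P.1) :
    P.zeroDegree z = P.codim ⟨z, h⟩ := dif_pos h

/-- The joint reduction modulo `y` at all places in `S`. -/
def reduceAll (S : Finset (Place K L)) {y : L} (hS : ∀ P ∈ S, y ∈ P.1) :
    regular S →ₗ[K] ∀ P : S, P.1.1 ⧸ Ideal.span {(⟨y, hS P P.2⟩ : P.1.1)} :=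
  LinearMap.pi fun P =>
    reduce P.1 (regular S).subtype (fun v => mem_regular.1 v.2 P.1 P.2)
      (Ideal.span {(⟨y, hS P P.2⟩ : P.1.1)})

theorem reduceAll_mul_eq_zero (S : Finset (Place K L)) {y : L} (hS : ∀ P ∈ S, y ∈ P.1)
    (m : L) (hm : m ∈ regular S) (hym : y * m ∈ regular S) : reduceAll S hS ⟨y * m, hym⟩ = 0 := by
  refine funext fun P => (P.1.reduce_eq_zero_iff _ _ _ _).2 ?_
  simpa using mul_le_of_le_one_right' ((P.1.1.valuation_le_one_iff _).2 (mem_regular.1 hm P P.2))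

theorem reduceAll_surjective (hfin : ∀ y : L, Transcendental K y →
    FiniteDimensional (IntermediateField.adjoin K ({y} : Set L)) L)
    (S : Finset (Place K L)) {y : L} (hy : y ≠ 0) (hS : ∀ P ∈ S, y ∈ P.1) :
    Function.Surjective (reduceAll S hS) := by
  intro x
  choose x' hx' using fun P : S => Ideal.Quotient.mk_surjective (x P)
  classical
  obtain ⟨z, hz⟩ := exists_forall_valuation_sub_le hfin S
    (fun P => if h : P ∈ S then (x' ⟨P, h⟩ : L) else 0) hy
  have hz' (P : S) : P.1.1.valuation (z - x' P) ≤ P.1.1.valuation y := by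
    simpa using hz P P.2
  have hzS : z ∈ regular S := fun P hP => by
    have h := add_mem (P.1.mem_of_valuation_le_one _
      ((hz' ⟨P, hP⟩).trans ((P.1.valuation_le_one_iff _).2 (hS P hP)))) (x' ⟨P, hP⟩).2
    simpa using h
  refine ⟨⟨z, hzS⟩, funext fun P => ?_⟩
  rw [← hx' P]
  refine Ideal.Quotient.eq.2 (Ideal.mem_span_singleton'.2 ?_)
  obtain ⟨c, hc⟩ := (P.1.1.valuation_le_iff _ _).1 (hz' P)
  exact ⟨c, Subtype.ext hc⟩

theorem finrank_pi_quotient (hfin : ∀ y : L, Transcendental K y →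
    FiniteDimensional (IntermediateField.adjoin K ({y} : Set L)) L)
    (S : Finset (Place K L)) {y : L} (hy : y ≠ 0) (hS : ∀ P ∈ S, y ∈ P.1) :
    Module.finrank K (∀ P : S, P.1.1 ⧸ Ideal.span {(⟨y, hS P P.2⟩ : P.1.1)}) =
      ∑ P ∈ S, P.zeroDegree y := by
  have (P : S) : Module.Finite K (P.1.1 ⧸ Ideal.span {(⟨y, hS P P.2⟩ : P.1.1)}) :=
    P.1.finite_quotient_span hfin _ (by simpa [Subtype.ext_iff] using hy)
  rw [Module.finrank_pi_fintype, ← Finset.sum_coe_sort S fun P => P.zeroDegree y]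
  exact Finset.sum_congr rfl fun P _ => (P.1.zeroDegree_of_mem (hS P P.2)).symm

theorem sum_zeroDegree_le (hfin : ∀ y : L, Transcendental K y →
    FiniteDimensional (IntermediateField.adjoin K ({y} : Set L)) L) {y : L}
    (hy : Transcendental K y) (S : Finset (Place K L)) (hS : ∀ P ∈ S, y ∈ P.1) :
    ∑ P ∈ S, P.zeroDegree y ≤
      Module.finrank (IntermediateField.adjoin K ({y} : Set L)) L := by
  have hy0 : y ≠ 0 := fun h => hy (h ▸ isAlgebraic_zero)
  have := hfin y hy
  rw [← finrank_pi_quotient hfin S hy0 hS]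
  exact (finite_and_finrank_le_of_surjective (M := regular S) hy0
    (fun m hm P hP => mul_mem (hS P hP) (hm P hP))
    (fun m => reduceAll_mul_eq_zero S hS m m.2 _) (reduceAll_surjective hfin S hy0 hS)).2

end Place

namespace Place
open Filter Polynomial

variable {K L : Type*} [Field K] [Field L] [Algebra K L]

/-- Every transcendental element has a zero. -/
theorem exists_valuation_lt_one {y : L} (hy : Transcendental K y) :
    ∃ P : Place K L, P.1.valuation y < 1 := by
  let A := (Algebra.adjoin K {y}).toSubring
  let y' : A := ⟨y, Algebra.self_mem_adjoin_singleton K y⟩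
  have hI : Ideal.span {y'} ≠ ⊤ := by
    rw [Ne, Ideal.span_singleton_eq_top]
    intro hu
    obtain ⟨⟨z, hz⟩, hyz⟩ := hu.exists_right_inv
    have hz : z ∈ Algebra.adjoin K {y} := hz
    rw [Algebra.adjoin_singleton_eq_range_aeval] at hz
    obtain ⟨p, rfl⟩ := hz
    have hyz : y * aeval y p = 1 := congrArg Subtype.val hyz
    have h0 : X * p - 1 = 0 := by
      refine transcendental_iff.1 hy _ ?_
      simpa [sub_eq_zero] using hyz
    simpa using congrArg (eval 0) h0
  obtain ⟨B, hAB, hIB⟩ := Ideal.image_subset_nonunits_valuationSubring _ hI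
  have hyB : B.valuation y < 1 :=
    B.mem_nonunits_iff.1 (hIB ⟨y', Ideal.mem_span_singleton_self y', rfl⟩)
  refine ⟨⟨B, ?_, ?_⟩, hyB⟩
  · rintro _ ⟨a, rfl⟩
    exact hAB ((Algebra.adjoin K {y}).algebraMap_mem a)
  · rintro rfl
    have h0 : y ≠ 0 := fun h => hy (h ▸ isAlgebraic_zero)
    have := (ValuationSubring.valuation_le_one_iff _ y⁻¹).2 (ValuationSubring.mem_top y⁻¹)
    rw [map_inv₀, inv_le_one₀ ((Valuation.pos_iff _).2 h0)] at this
    exact this.not_gt hyB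

theorem eq_zero_of_forall_mem {z : L} (hz : ∀ P : Place K L, z ∈ P.1) {P : Place K L}
    (hP : P.1.valuation z < 1) : z = 0 := by
  by_contra h0
  have htr := P.transcendental_of_valuation_lt_one hP h0
  obtain ⟨Q, hQ⟩ := exists_valuation_lt_one (K := K) (y := z⁻¹) fun h =>
    htr (inv_inv z ▸ h.inv)
  rw [map_inv₀, inv_lt_one₀ ((Valuation.pos_iff _).2 h0)] at hQ
  exact hQ.not_ge ((Q.1.valuation_le_one_iff z).2 (hz Q))

theorem mem_of_isIntegral_adjoin (P : Place K L) {t z : L} (ht : t ∈ P.1)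
    (hz : IsIntegral (Algebra.adjoin K {t}) z) : z ∈ P.1 := by
  have hle : ∀ a : Algebra.adjoin K {t}, (a : L) ∈ P.1 := fun a =>
    Algebra.adjoin_induction (p := fun a _ => a ∈ P.1) (by simpa using ht)
      (fun r => P.algebraMap_mem r) (fun _ _ _ _ => add_mem) (fun _ _ _ _ => mul_mem) a.2
  let i : Algebra.adjoin K {t} →+* P.1 := (algebraMap (Algebra.adjoin K {t}) L).codRestrict P.1 hle
  obtain ⟨p, hp, hpz⟩ := hz
  refine P.mem_of_isIntegral ⟨p.map i, hp.map i, ?_⟩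
  rw [eval₂_map]
  exact hpz

theorem linearIndependent_pow_of_transcendental {R A : Type*} [CommRing R] [CommRing A]
    [Algebra R A] {t : A} (ht : Transcendental R t) : LinearIndependent R fun k : ℕ => t ^ k := by
  have h := (Polynomial.basisMonomials R).linearIndependent.map' (aeval t).toLinearMap
    (LinearMap.ker_eq_bot.2 (transcendental_iff_injective.1 ht))
  have heq : (fun k : ℕ => t ^ k) =
      ⇑(aeval (R := R) t).toLinearMap ∘ ⇑(Polynomial.basisMonomials R) := by
    ext k
    simp [aeval_monomial]
  rw [heq]
  exact h

theorem finrank_le_sum_zeroDegree_of_forall (hfin : ∀ y : L, Transcendental K y →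
    FiniteDimensional (IntermediateField.adjoin K ({y} : Set L)) L) {V : Type*} [AddCommGroup V]
    [Module K V] (f : V →ₗ[K] L) (S : Finset (Place K L)) {z : L} (hz : z ≠ 0)
    (hS : ∀ P ∈ S, z ∈ P.1) (hf : ∀ P ∈ S, ∀ v, f v ∈ P.1)
    (h0 : ∀ v, (∀ P ∈ S, P.1.valuation (f v) ≤ P.1.valuation z) → v = 0) :
    Module.finrank K V ≤ ∑ P ∈ S, P.zeroDegree z := by
  let φ : V →ₗ[K] ∀ P : S, P.1.1 ⧸ Ideal.span {(⟨z, hS P P.2⟩ : P.1.1)} :=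
    LinearMap.pi fun P =>
      reduce P.1 f (hf P P.2) (Ideal.span {(⟨z, hS P P.2⟩ : P.1.1)})
  have hφ : Function.Injective φ := by
    rw [← LinearMap.ker_eq_bot, LinearMap.ker_eq_bot']
    exact fun v hv => h0 v fun P hP => (P.reduce_eq_zero_iff f (hf P hP) ⟨z, hS P hP⟩ v).1
      (congrFun hv ⟨P, hP⟩)
  have (P : S) : Module.Finite K (P.1.1 ⧸ Ideal.span {(⟨z, hS P P.2⟩ : P.1.1)}) :=
    P.1.finite_quotient_span hfin _ (by simpa [Subtype.ext_iff] using hz)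
  rw [← finrank_pi_quotient hfin S hz hS]
  exact LinearMap.finrank_le_finrank_of_injective hφ

theorem zeroDegree_pow (hfin : ∀ y : L, Transcendental K y →
    FiniteDimensional (IntermediateField.adjoin K ({y} : Set L)) L) (P : Place K L) {z : L}
    (h0 : z ≠ 0) (hz : z ∈ P.1) (n : ℕ) : P.zeroDegree (z ^ n) = n * P.zeroDegree z := by
  rw [P.zeroDegree_of_mem hz, P.zeroDegree_of_mem (pow_mem hz n), ← P.codim_pow hfin]
  · rfl
  · simpa [Subtype.ext_iff] using h0

theorem exists_basis_isIntegral (t : L)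
    [FiniteDimensional (IntermediateField.adjoin K ({t} : Set L)) L] :
    ∃ (s : Finset L) (b : Module.Basis s (IntermediateField.adjoin K ({t} : Set L)) L),
      ∀ j, IsIntegral (Algebra.adjoin K {t}) (b j) := by
  open scoped IntermediateField.algebraAdjoinAdjoin in
  exact FiniteDimensional.exists_is_basis_integral (Algebra.adjoin K {t})
    (IntermediateField.adjoin K ({t} : Set L)) L

theorem linearIndependent_pow_mul {ι : Type*} {t : L} (ht : Transcendental K t)
    (b : Module.Basis ι (IntermediateField.adjoin K ({t} : Set L)) L) (l : ℕ) :
    LinearIndependent K fun p : Fin l × ι => t ^ (p.1 : ℕ) * b p.2 := by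
  let t' : IntermediateField.adjoin K ({t} : Set L) :=
    ⟨t, IntermediateField.mem_adjoin_simple_self K t⟩
  have ht' : Transcendental K t' := fun h => ht (h.algebraMap (A := L))
  exact linearIndependent_smul ((linearIndependent_pow_of_transcendental ht').comp
    (Fin.val (n := l)) Fin.val_injective) b.linearIndependent

theorem pow_add_mul_inv_pow_mul {y : L} (hy : y ≠ 0) (b : L) (c : ℕ) {k l : ℕ} (hk : k ≤ l) :
    y ^ (c + l) * (y⁻¹ ^ k * b) = y ^ (l - k) * (y ^ c * b) := by
  obtain ⟨m, rfl⟩ := Nat.exists_eq_add_of_le hk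
  rw [Nat.add_sub_cancel_left, inv_pow, pow_add, pow_add]
  field_simp

theorem exists_pow_mul_mem (hfin : ∀ y : L, Transcendental K y →
    FiniteDimensional (IntermediateField.adjoin K ({y} : Set L)) L) {ι : Type*} [Finite ι]
    (S : Finset (Place K L)) {y : L} (hS : ∀ P ∈ S, P.1.valuation y < 1)
    (b : ι → L) (hb : ∀ j, b j ≠ 0) : ∃ c : ℕ, ∀ P ∈ S, ∀ j, y ^ c * b j ∈ P.1 := by
  have hev : ∀ᶠ c : ℕ in atTop, ∀ P ∈ S, ∀ j, P.1.valuation (y ^ c) ≤ P.1.valuation (1 / b j) :=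
    (eventually_all_finset _).2 fun P hP => eventually_all.2 fun j =>
      P.eventually_valuation_pow_le hfin (hS P hP) (one_div_ne_zero (hb j))
  obtain ⟨c, hc⟩ := hev.exists
  refine ⟨c, fun P hP j => P.1.mem_of_valuation_le_one _ ?_⟩
  have h := hc P hP j
  rwa [map_div₀, map_one, le_div_iff₀ ((Valuation.pos_iff _).2 (hb j)), ← map_mul] at h

theorem finrank_le_sum_zeroDegree (hfin : ∀ y : L, Transcendental K y →
    FiniteDimensional (IntermediateField.adjoin K ({y} : Set L)) L) {y : L}
    (hy : Transcendental K y) (S : Finset (Place K L))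
    (hS : ∀ P : Place K L, P ∈ S ↔ P.1.valuation y < 1) :
    Module.finrank (IntermediateField.adjoin K ({y⁻¹} : Set L)) L ≤ ∑ P ∈ S, P.zeroDegree y := by
  have hy0 : y ≠ 0 := fun h => hy (h ▸ isAlgebraic_zero)
  have ht : Transcendental K y⁻¹ := fun h => hy (inv_inv y ▸ h.inv)
  have := hfin _ ht
  obtain ⟨P₀, hP₀⟩ := exists_valuation_lt_one hy
  have hSmem : ∀ P ∈ S, y ∈ P.1 := fun P hP => P.1.mem_of_valuation_le_one _ ((hS P).1 hP).le
  have htmem : ∀ P ∉ S, y⁻¹ ∈ P.1 := fun P hP => by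
    refine P.1.mem_of_valuation_le_one _ ?_
    rw [map_inv₀, inv_le_one₀ ((Valuation.pos_iff _).2 hy0)]
    exact not_lt.1 (mt (hS P).2 hP)
  obtain ⟨s, b, hb⟩ := exists_basis_isIntegral (K := K) y⁻¹
  obtain ⟨c, hc⟩ := exists_pow_mul_mem hfin S (fun P => (hS P).1) b b.ne_zero
  suffices h : ∀ l : ℕ, l * Module.finrank (IntermediateField.adjoin K ({y⁻¹} : Set L)) L ≤
      (c + l + 1) * ∑ P ∈ S, P.zeroDegree y by
    by_contra! hlt
    generalize ∑ P ∈ S, P.zeroDegree y = d at h hlt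
    have h₁ := h ((c + 1) * d + 1)
    have h₂ := Nat.mul_le_mul_left ((c + 1) * d + 1) (Nat.succ_le_of_lt hlt)
    rw [Nat.succ_eq_add_one] at h₂
    nlinarith
  intro l
  have hv := linearIndependent_pow_mul ht b l
  set W := Submodule.span K (Set.range fun p : Fin l × s => y⁻¹ ^ (p.1 : ℕ) * b p.2)
  have hWrank : Module.finrank K W =
      l * Module.finrank (IntermediateField.adjoin K ({y⁻¹} : Set L)) L := by
    rw [finrank_span_eq_card hv, Module.finrank_eq_card_basis b, Fintype.card_prod,
      Fintype.card_fin]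
  have hW₁ : ∀ P ∉ S, ∀ w ∈ W, w ∈ P.1 := by
    intro P hP w hw
    rw [← mem_regular_singleton]
    refine (Submodule.span_le.2 ?_ : W ≤ regular {P}) hw
    rintro _ ⟨p, rfl⟩
    exact P.mem_regular_singleton.2
      (mul_mem (pow_mem (htmem P hP) _) (P.mem_of_isIntegral_adjoin (htmem P hP) (hb _)))
  have hW₂ : ∀ P ∈ S, ∀ w ∈ W, y ^ (c + l) * w ∈ P.1 := by
    intro P hP w hw
    rw [← mem_regular_singleton]
    refine (Submodule.span_le.2 ?_ :
      W ≤ (regular {P}).comap (LinearMap.mulLeft K (y ^ (c + l)))) hw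
    rintro _ ⟨p, rfl⟩
    refine P.mem_regular_singleton.2 ?_
    rw [LinearMap.mulLeft_apply, pow_add_mul_inv_pow_mul hy0 _ _ p.1.2.le]
    exact mul_mem (pow_mem (hSmem P hP) _) (hc P hP _)
  have hrank := finrank_le_sum_zeroDegree_of_forall hfin
    ((LinearMap.mulLeft K (y ^ (c + l))).comp W.subtype) S (pow_ne_zero (c + l + 1) hy0)
    (fun P hP => pow_mem (hSmem P hP) _) (fun P hP w => hW₂ P hP w w.2) fun w hw => ?_
  · rw [hWrank] at hrank
    refine hrank.trans_eq ?_
    rw [Finset.mul_sum]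
    exact Finset.sum_congr rfl fun P hP => P.zeroDegree_pow hfin hy0 (hSmem P hP) _
  have hlt : ∀ P ∈ S, P.1.valuation (w : L) < 1 := by
    intro P hP
    have h : P.1.valuation (y ^ (c + l) * w) ≤ P.1.valuation (y ^ (c + l + 1)) := hw P hP
    rw [pow_succ, map_mul, map_mul,
      mul_le_mul_iff_right₀ ((Valuation.pos_iff _).2 (pow_ne_zero _ hy0))] at h
    exact h.trans_lt ((hS P).1 hP)
  ext
  refine eq_zero_of_forall_mem (fun P => ?_) (hlt P₀ ((hS P₀).2 hP₀))
  by_cases hP : P ∈ S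
  · exact P.1.mem_of_valuation_le_one _ (hlt P hP).le
  · exact hW₁ P hP w w.2

theorem adjoin_inv_eq (y : L) :
    IntermediateField.adjoin K ({y⁻¹} : Set L) = IntermediateField.adjoin K {y} := by
  apply le_antisymm <;> rw [IntermediateField.adjoin_simple_le_iff]
  · exact inv_mem (IntermediateField.mem_adjoin_simple_self K y)
  · simpa using inv_mem (IntermediateField.mem_adjoin_simple_self K y⁻¹)

theorem zeroDegree_eq_zero (P : Place K L) {z : L} (hz : 1 ≤ P.1.valuation z) :
    P.zeroDegree z = 0 := by
  rw [zeroDegree]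
  split_ifs with h
  · refine P.codim_of_isUnit ((P.1.valuation_eq_one_iff _).2 (le_antisymm ?_ hz))
    exact (P.1.valuation_le_one_iff z).2 h
  · rfl

theorem zeroDegree_pos (hfin : ∀ y : L, Transcendental K y →
    FiniteDimensional (IntermediateField.adjoin K ({y} : Set L)) L) (P : Place K L) {z : L}
    (h0 : z ≠ 0) (hz : P.1.valuation z < 1) : 0 < P.zeroDegree z := by
  rw [P.zeroDegree_of_mem (P.1.mem_of_valuation_le_one _ hz.le)]
  refine P.codim_pos hfin (by simpa [Subtype.ext_iff] using h0) fun hu => ?_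
  exact hz.ne ((P.1.valuation_eq_one_iff _).1 hu)

theorem finite_zeros (hfin : ∀ y : L, Transcendental K y →
    FiniteDimensional (IntermediateField.adjoin K ({y} : Set L)) L) {y : L}
    (hy : Transcendental K y) : {P : Place K L | P.1.valuation y < 1}.Finite := by
  by_contra hinf
  obtain ⟨S, hS, hcard⟩ := Set.Infinite.exists_subset_card_eq hinf
    (Module.finrank (IntermediateField.adjoin K ({y} : Set L)) L + 1)
  have h := sum_zeroDegree_le hfin hy S fun P hP =>
    P.1.mem_of_valuation_le_one _ (hS hP : P.1.valuation y < 1).le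
  have h' : ∑ P ∈ S, 1 ≤ ∑ P ∈ S, P.zeroDegree y := Finset.sum_le_sum fun P hP =>
    P.zeroDegree_pos hfin (fun h => hy (h ▸ isAlgebraic_zero)) (hS hP)
  simp only [Finset.sum_const, smul_eq_mul, mul_one] at h'
  lia

theorem support_zeroDegree_subset (z : L) :
    (Function.support fun P : Place K L => P.zeroDegree z) ⊆ {P | P.1.valuation z < 1} := by
  intro P hP
  by_contra h
  exact hP (P.zeroDegree_eq_zero (not_lt.1 h))

/-- The degree of the divisor of zeros of a transcendental element `y` is `[L : K(y)]`. -/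
theorem finsum_zeroDegree (hfin : ∀ y : L, Transcendental K y →
    FiniteDimensional (IntermediateField.adjoin K ({y} : Set L)) L) {y : L}
    (hy : Transcendental K y) : ∑ᶠ P : Place K L, P.zeroDegree y =
      Module.finrank (IntermediateField.adjoin K ({y} : Set L)) L := by
  have hS (P : Place K L) : P ∈ (finite_zeros hfin hy).toFinset ↔ P.1.valuation y < 1 := by simp
  rw [finsum_eq_sum_of_support_subset (s := (finite_zeros hfin hy).toFinset) _
    (by simpa using support_zeroDegree_subset y)]
  refine le_antisymm (sum_zeroDegree_le hfin hy _ fun P hP =>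
    P.1.mem_of_valuation_le_one _ ((hS P).1 hP).le) ?_
  rw [← adjoin_inv_eq]
  exact finrank_le_sum_zeroDegree hfin hy _ hS

end Place

namespace Place

variable {K L : Type} [Field K] [Field L] [Algebra K L]

theorem resDeg_fieldRange (P : Place K L) : resDeg (algebraMap K L).fieldRange P.1 =
    Module.finrank K (P.1 ⧸ IsLocalRing.maximalIdeal P.1) := by
  rw [resDeg, dif_pos P.2.1]
  let _ : Module (algebraMap K L).fieldRange (P.1 ⧸ IsLocalRing.maximalIdeal P.1) :=
    Module.compHom _ ((Ideal.Quotient.mk (IsLocalRing.maximalIdeal P.1)).comp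
        { toFun := fun x => (⟨(x : L), P.2.1 x.2⟩ : P.1),
          map_one' := rfl, map_mul' := fun _ _ => rfl,
          map_zero' := rfl, map_add' := fun _ _ => rfl })
  refine (congrArg Cardinal.toNat (rank_eq_of_equiv_equiv
    (R := K) (R' := (algebraMap K L).fieldRange)
    (algebraMap K L).rangeRestrictField
    (AddEquiv.refl (P.1 ⧸ IsLocalRing.maximalIdeal P.1))
    (algebraMap K L).rangeRestrictField_bijective ?_)).symm
  intro a z
  obtain ⟨w, rfl⟩ := Ideal.Quotient.mk_surjective z
  rw [Algebra.smul_def]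
  rfl

theorem natOrd_of_notMem (P : Place K L) {z : L} (hz : z ∉ P.1) : natOrd P.1 z = 0 := by
  have : {n : ℕ | ∃ y : P.1, (y : L) = z ∧ y ∈ (IsLocalRing.maximalIdeal P.1) ^ n} = ∅ := by
    refine Set.eq_empty_of_forall_notMem ?_
    rintro n ⟨y, rfl, -⟩
    exact hz y.2
  rw [natOrd, this, csSup_empty, bot_eq_zero]

theorem natOrd_pow_mul_unit (P : Place K L) {p : P.1} (hp : p ≠ 0)
    (hm : IsLocalRing.maximalIdeal P.1 = Ideal.span {p}) (hp' : ¬ IsUnit p)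
    (u : P.1ˣ) (e : ℕ) : natOrd P.1 ((u * p ^ e : P.1) : L) = e := by
  have : {n : ℕ | ∃ y : P.1, (y : L) = ((u * p ^ e : P.1) : L) ∧
      y ∈ (IsLocalRing.maximalIdeal P.1) ^ n} = Set.Iic e := by
    ext n
    constructor
    · rintro ⟨y, hy, hyn⟩
      rw [Subtype.ext hy, hm, Ideal.span_singleton_pow, Ideal.mem_span_singleton,
        Units.dvd_mul_left, pow_dvd_pow_iff hp hp'] at hyn
      exact hyn
    · intro hn
      refine ⟨_, rfl, ?_⟩
      rw [hm, Ideal.span_singleton_pow, Ideal.mem_span_singleton, Units.dvd_mul_left]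
      exact pow_dvd_pow p hn
  rw [natOrd, this, csSup_Iic]

theorem natOrd_mul_resDeg (hfin : ∀ y : L, Transcendental K y →
    FiniteDimensional (IntermediateField.adjoin K ({y} : Set L)) L) (P : Place K L) {z : L}
    (hz : z ≠ 0) : natOrd P.1 z * resDeg (algebraMap K L).fieldRange P.1 = P.zeroDegree z := by
  by_cases hzP : z ∈ P.1
  · have := P.isDiscreteValuationRing hfin
    obtain ⟨p, hp⟩ := IsDiscreteValuationRing.exists_irreducible P.1
    obtain ⟨e, u, hu⟩ := IsDiscreteValuationRing.eq_unit_mul_pow_irreducible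
      (x := (⟨z, hzP⟩ : P.1)) (by simpa [Subtype.ext_iff] using hz) hp
    have hres : resDeg (algebraMap K L).fieldRange P.1 = P.codim p := by
      rw [resDeg_fieldRange, hp.maximalIdeal_eq, codim]
    have hz' : z = ((u * p ^ e : P.1) : L) := congrArg Subtype.val hu
    rw [P.zeroDegree_of_mem hzP, hu, P.codim_mul hfin u.ne_zero (pow_ne_zero e hp.ne_zero),
      P.codim_of_isUnit u.isUnit, P.codim_pow hfin hp.ne_zero, zero_add, hres, hz',
      P.natOrd_pow_mul_unit hp.ne_zero hp.maximalIdeal_eq hp.not_isUnit]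
  · rw [P.natOrd_of_notMem hzP, zero_mul, zeroDegree, dif_neg hzP]

theorem intOrd_mul_resDeg (hfin : ∀ y : L, Transcendental K y →
    FiniteDimensional (IntermediateField.adjoin K ({y} : Set L)) L) (P : Place K L) {z : L}
    (hz : z ≠ 0) : intOrd P.1 z * (resDeg (algebraMap K L).fieldRange P.1 : ℤ) =
      P.zeroDegree z - P.zeroDegree z⁻¹ := by
  rw [intOrd, sub_mul, ← P.natOrd_mul_resDeg hfin hz, ← P.natOrd_mul_resDeg hfin (inv_ne_zero hz)]
  push_cast
  rfl

theorem finsum_zeroDegree_sub_zeroDegree_inv (hfin : ∀ y : L, Transcendental K y →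
    FiniteDimensional (IntermediateField.adjoin K ({y} : Set L)) L) {z : L} (hz : z ≠ 0) :
    ∑ᶠ P : Place K L, ((P.zeroDegree z : ℤ) - P.zeroDegree z⁻¹) = 0 := by
  by_cases halg : IsAlgebraic K z
  · have h (P : Place K L) : ((P.zeroDegree z : ℤ) - P.zeroDegree z⁻¹) = 0 := by
      rw [P.zeroDegree_eq_zero (P.valuation_eq_one_of_isAlgebraic halg hz).ge,
        P.zeroDegree_eq_zero (P.valuation_eq_one_of_isAlgebraic halg.inv (inv_ne_zero hz)).ge,
        sub_self]
    simp [h]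
  have hinv : Transcendental K z⁻¹ := fun h => halg (inv_inv z ▸ h.inv)
  have hsupp {w : L} (hw : Transcendental K w) :
      (Function.support fun P : Place K L => P.zeroDegree w).Finite :=
    (finite_zeros hfin hw).subset (support_zeroDegree_subset w)
  have hcast {w : L} (hw : Transcendental K w) :
      ∑ᶠ P : Place K L, (P.zeroDegree w : ℤ) =
        Module.finrank (IntermediateField.adjoin K ({w} : Set L)) L := by
    rw [← finsum_zeroDegree hfin hw]
    exact ((Nat.castAddMonoidHom ℤ).map_finsum (hsupp hw)).symm
  rw [finsum_sub_distrib, hcast halg, hcast hinv, adjoin_inv_eq, sub_self]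
  · exact (hsupp halg).subset fun P => by simp
  · exact (hsupp hinv).subset fun P => by simp

end Place

/-- For a function field in one variable `L/K` (finitely generated of
transcendence degree one) and `g ∈ L*`, the principal divisor `div(g)` has degree zero:
`Σ_{R ∈ V(L/K)} v_R(g)·[R/m_R : K] = 0`, the sum ranging over the valuation rings of `L/K`
(i.e. `K ⊆ R ⊆ L`, `Frac R = L`, `R ≠ L`). -/
theorem stmt10 (K L : Type) [Field K] [Field L] [Algebra K L]
    (hfg : ∃ s : Finset L, IntermediateField.adjoin K (s : Set L) = ⊤)
    (x : L) (hx : Transcendental K x)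
    (halg : Algebra.IsAlgebraic (IntermediateField.adjoin K ({x} : Set L)) L)
    (g : L) (hg : g ≠ 0) :
    ∑ᶠ R ∈ {R : ValuationSubring L |
        (((algebraMap K L).fieldRange : Subfield L) : Set L) ⊆ (R : Set L) ∧ R ≠ ⊤},
      intOrd R g * (resDeg (algebraMap K L).fieldRange R : ℤ) = 0 := by
  have hfin (y : L) (hy : Transcendental K y) :=
    finiteDimensional_adjoin_of_transcendental hfg hx halg hy
  rw [← finsum_set_coe_eq_finsum_mem]
  exact (finsum_congr fun P : Place K L => P.intOrd_mul_resDeg hfin hg).trans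
    (Place.finsum_zeroDegree_sub_zeroDegree_inv hfin hg)
end

section
/- Let k be a field, A = k[X,Y], F ∈ A \ k, and define d₁,…,d_t to be the residue degrees [R/m_R : k(F)] over the dicriticals R of F, i.e., the valuation rings R of Frac(A)/k(F) with Frac(R) = Frac(A), R ≠ Frac(A), k(F) ⊆ R, and A ⊄ R. Then gcd(d₁,…,d_t) = η(Frac(A)/k(F)), where η(L/K) = gcd of [R/m_R : K] over all valuation rings R of L/K. In particular, if k(F,G) = k(X,Y) for some G ∈ k(X,Y), then gcd(d₁,…,d_t) = 1. -/
open MvPolynomial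

section Scaled

variable {K L : Type*} [Field K] [Field L] [Algebra K L]

/-- The translate `a • D` of a subalgebra `D` of a field, for `a ≠ 0`. -/
def Subalgebra.translate (D : Subalgebra K L) (a : L) : Submodule K L :=
  (Subalgebra.toSubmodule D).comap (LinearMap.mulLeft K a⁻¹)

theorem Subalgebra.mem_translate {D : Subalgebra K L} {a v : L} :
    v ∈ D.translate a ↔ a⁻¹ * v ∈ D := Iff.rfl

theorem Subalgebra.translate_one (D : Subalgebra K L) :
    D.translate 1 = Subalgebra.toSubmodule D := by
  ext; simp [Subalgebra.mem_translate]

theorem Subalgebra.translate_le {D : Subalgebra K L} {a b : L} (ha : a ≠ 0) (h : a * b⁻¹ ∈ D) :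
    D.translate a ≤ D.translate b := by
  intro v hv
  rw [mem_translate] at hv ⊢
  convert D.mul_mem h hv using 1
  field_simp

theorem Subalgebra.mul_mem_translate {D : Subalgebra K L} {a c v : L} (hc : c ≠ 0) :
    c * v ∈ D.translate (c * a) ↔ v ∈ D.translate a := by
  rw [mem_translate, mem_translate]
  convert Iff.rfl using 2
  field_simp

theorem Subalgebra.translate_sup_eq_top_mul {D B : Subalgebra K L} {a b c : L} (hc : c ≠ 0)
    (h : D.translate a ⊔ B.translate b = ⊤) :
    D.translate (c * a) ⊔ B.translate (c * b) = ⊤ := by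
  rw [eq_top_iff]
  rintro v -
  have hv : c⁻¹ * v ∈ D.translate a ⊔ B.translate b := h ▸ Submodule.mem_top
  obtain ⟨y, hy, z, hz, hyz⟩ := Submodule.mem_sup.1 hv
  refine Submodule.mem_sup.2 ⟨c * y, (mul_mem_translate hc).2 hy, c * z,
    (mul_mem_translate hc).2 hz, ?_⟩
  rw [← mul_add, hyz, mul_inv_cancel_left₀ hc]

/-- Multiplication by `c` identifies the intersections of translates. -/
noncomputable def Subalgebra.translateInfEquiv (D B : Subalgebra K L) (a b : L) {c : L}
    (hc : c ≠ 0) :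
    ↥(D.translate a ⊓ B.translate b) ≃ₗ[K] ↥(D.translate (c * a) ⊓ B.translate (c * b)) where
  toFun v := ⟨c * v, (mul_mem_translate hc).2 v.2.1, (mul_mem_translate hc).2 v.2.2⟩
  invFun v := ⟨c⁻¹ * v, by
    have h1 := v.2.1
    have h2 := v.2.2
    rw [← mul_inv_cancel_left₀ hc (v : L)] at h1 h2
    exact ⟨(mul_mem_translate hc).1 h1, (mul_mem_translate hc).1 h2⟩⟩
  map_add' x y := by ext; simp [mul_add]
  map_smul' r x := by ext; simp
  left_inv x := by ext; simp [hc]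
  right_inv x := by ext; simp [hc]

theorem Subalgebra.finrank_translate_inf (D : Subalgebra K L) {a : L} (ha : a ≠ 0) {x : D}
    (hx : x ≠ 0) {Q : Submodule K L} (hQ : D.translate (a * x) ⊔ Q = ⊤)
    [FiniteDimensional K ↥(D.translate a ⊓ Q)] :
    Module.finrank K ↥(D.translate a ⊓ Q) =
      Module.finrank K ↥(D.translate (a * x) ⊓ Q) + Module.finrank K (D ⧸ Ideal.span {x}) := by
  have hx' : (x : L) ≠ 0 := fun h => hx (Subtype.ext h)
  let f : ↥(D.translate a ⊓ Q) →ₗ[K] D :=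
    { toFun := fun v => ⟨a⁻¹ * v, v.2.1⟩
      map_add' := fun x y => by ext; simp [mul_add]
      map_smul' := fun r x => by ext; simp }
  let g : ↥(D.translate a ⊓ Q) →ₗ[K] D ⧸ Ideal.span {x} :=
    (Ideal.Quotient.mkₐ K (Ideal.span {x})).toLinearMap.comp f
  have hsurj : Function.Surjective g := by
    intro y
    obtain ⟨d, rfl⟩ := Ideal.Quotient.mk_surjective y
    have hd : a * d ∈ D.translate (a * x) ⊔ Q := hQ ▸ Submodule.mem_top
    obtain ⟨u, hu, q, hq, h⟩ := Submodule.mem_sup.1 hd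
    rw [mem_translate] at hu
    have e : a⁻¹ * q = d - x * ((a * x)⁻¹ * u) := by
      have : q = a * d - u := by rw [← h]; ring
      rw [this]; field_simp
    have hqa : q ∈ D.translate a := by
      rw [mem_translate, e]
      exact D.sub_mem d.2 (D.mul_mem x.2 hu)
    refine ⟨⟨q, hqa, hq⟩, ?_⟩
    refine Ideal.Quotient.eq.2 (Ideal.mem_span_singleton.2 ⟨-⟨_, hu⟩, ?_⟩)
    ext
    simp only [f, LinearMap.coe_mk, AddHom.coe_mk, Subalgebra.coe_sub, Subalgebra.coe_mul,
      Subalgebra.coe_neg]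
    rw [e]; ring
  have hker : (LinearMap.ker g).map (Submodule.subtype _) = D.translate (a * x) ⊓ Q := by
    ext v
    constructor
    · rintro ⟨w, hw, rfl⟩
      obtain ⟨y, hy⟩ := Ideal.mem_span_singleton.1 (Ideal.Quotient.eq_zero_iff_mem.1 hw)
      have hy' : a⁻¹ * (w : L) = x * y := congrArg Subtype.val hy
      refine ⟨?_, w.2.2⟩
      change (a * x : L)⁻¹ * w ∈ D
      convert y.2 using 1
      rw [mul_inv, mul_right_comm, hy']; field_simp
    · rintro ⟨h1, h2⟩
      have h1' := (mem_translate.1 h1)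
      have e : a⁻¹ * v = x * ((a * x)⁻¹ * v) := by field_simp
      refine ⟨⟨v, ?_, h2⟩, ?_, rfl⟩
      · change v ∈ D.translate a
        rw [mem_translate, e]
        exact D.mul_mem x.2 h1'
      · refine Ideal.Quotient.eq_zero_iff_mem.2 (Ideal.mem_span_singleton.2 ⟨⟨_, h1'⟩, ?_⟩)
        ext
        exact e
  rw [← LinearMap.finrank_range_add_finrank_ker g, LinearMap.range_eq_top.2 hsurj, finrank_top,
    ← hker, add_comm]
  congr 1
  exact (LinearEquiv.finrank_eq (Submodule.equivSubtypeMap _ _))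

end Scaled

section FinrankQuotient

open scoped Pointwise

variable {K B : Type*} [Field K] [CommRing B] [IsDomain B] [Algebra K B]

theorem finiteDimensional_and_finrank_quotient_span_mul {x y : B} (hx : x ≠ 0)
    [FiniteDimensional K (B ⧸ Ideal.span {x})] [FiniteDimensional K (B ⧸ Ideal.span {y})] :
    FiniteDimensional K (B ⧸ Ideal.span {x * y}) ∧
      Module.finrank K (B ⧸ Ideal.span {x * y}) =
        Module.finrank K (B ⧸ Ideal.span {x}) + Module.finrank K (B ⧸ Ideal.span {y}) := by
  have hxy : Ideal.span {x * y} = x • Ideal.span {y} := by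
    rw [← Submodule.singleton_set_smul]
    simp [← Ideal.submodule_span_eq, Submodule.set_smul_span]
  rw [hxy]
  let f := (Ideal.mulQuot x (Ideal.span {y})).restrictScalars K
  let g := (Ideal.quotOfMul x (Ideal.span {y})).restrictScalars K
  have hf : Function.Injective f :=
    Ideal.mulQuot_injective _ (mem_nonZeroDivisors_of_ne_zero hx)
  have hg : Function.Surjective g := Ideal.quotOfMul_surjective _
  have hfg : Function.Exact f g := Ideal.exact_mulQuot_quotOfMul _
  have hfin : FiniteDimensional K (B ⧸ x • Ideal.span {y}) := Module.Finite.of_exact hfg hg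
  refine ⟨hfin, ?_⟩
  rw [← LinearMap.finrank_range_add_finrank_ker g, LinearMap.range_eq_top.2 hg, finrank_top,
    LinearMap.exact_iff.1 hfg, LinearMap.finrank_range_of_inj hf]

theorem finiteDimensional_quotient_span_pow {x : B} (hx : x ≠ 0)
    [FiniteDimensional K (B ⧸ Ideal.span {x})] (j : ℕ) :
    FiniteDimensional K (B ⧸ Ideal.span {x ^ j}) := by
  induction j with
  | zero =>
    rw [pow_zero, Ideal.span_singleton_one]
    have : Subsingleton (B ⧸ (⊤ : Ideal B)) := Ideal.Quotient.subsingleton_iff.2 rfl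
    infer_instance
  | succ j ih =>
    rw [pow_succ']
    exact (finiteDimensional_and_finrank_quotient_span_mul hx).1

theorem dvd_finrank_quotient_span [IsPrincipalIdealRing B] {d : ℕ}
    (hfin : ∀ x : B, x ≠ 0 → FiniteDimensional K (B ⧸ Ideal.span {x}))
    (hd : ∀ P : Ideal B, P.IsMaximal → P ≠ ⊥ → d ∣ Module.finrank K (B ⧸ P)) {x : B}
    (hx : x ≠ 0) : d ∣ Module.finrank K (B ⧸ Ideal.span {x}) := by
  induction x using UniqueFactorizationMonoid.induction_on_prime with
  | h₁ => exact absurd rfl hx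
  | h₂ x hu =>
    rw [Ideal.span_singleton_eq_top.2 hu]
    have : Subsingleton (B ⧸ (⊤ : Ideal B)) := Ideal.Quotient.subsingleton_iff.2 rfl
    simp [Module.finrank_zero_of_subsingleton]
  | h₃ a p ha hp ih =>
    have := hfin p hp.ne_zero
    have := hfin a ha
    rw [(finiteDimensional_and_finrank_quotient_span_mul hp.ne_zero).2]
    refine dvd_add (hd _ ?_ (by simpa using hp.ne_zero)) (ih ha)
    exact PrincipalIdealRing.isMaximal_of_irreducible hp.irreducible

end FinrankQuotient

section PolarRing

open Polynomial

variable {K L : Type*} [Field K] [Field L] [Algebra K L]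

variable (K) in
/-- The intersection of all valuation rings of `L` over `K` which do not contain `t`. -/
def polarRing (t : L) : Subalgebra K L where
  carrier := {x | ∀ R : ValuationSubring L, (∀ c : K, algebraMap K L c ∈ R) → t ∉ R → x ∈ R}
  mul_mem' hx hy R h ht := R.mul_mem _ _ (hx R h ht) (hy R h ht)
  add_mem' hx hy R h ht := R.add_mem _ _ (hx R h ht) (hy R h ht)
  algebraMap_mem' c _ h _ := h c

theorem mem_polarRing {t x : L} : x ∈ polarRing K t ↔
    ∀ R : ValuationSubring L, (∀ c : K, algebraMap K L c ∈ R) → t ∉ R → x ∈ R := Iff.rfl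

theorem ValuationSubring.inv_mem_nonunits_of_notMem {R : ValuationSubring L} {t : L} (ht : t ∉ R) :
    t⁻¹ ∈ R.nonunits :=
  R.inv_mem_nonunits_iff.2 (Or.inr ht)

theorem inv_mem_polarRing (t : L) : t⁻¹ ∈ polarRing K t := fun _ _ ht =>
  ValuationSubring.nonunits_subset (ValuationSubring.inv_mem_nonunits_of_notMem ht)

theorem inv_add_mem_polarRing {t x : L} (hx : x ∈ polarRing K t) {c : K} (hc : c ≠ 0) :
    (algebraMap K L c + t⁻¹ * x)⁻¹ ∈ polarRing K t := by
  intro R hR ht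
  have hc' : algebraMap K L c ≠ 0 := by simpa using hc
  rw [← R.valuation_le_one_iff, map_inv₀]
  have h1 : R.valuation (algebraMap K L c) = 1 := by
    refine le_antisymm ((R.valuation_le_one_iff _).2 (hR c)) ?_
    have := (R.valuation_le_one_iff _).2 (hR c⁻¹)
    rw [map_inv₀, map_inv₀] at this
    exact (inv_le_one₀ (by simpa [zero_lt_iff] using hc')).1 this
  have h2 : R.valuation (t⁻¹ * x) < 1 := by
    rw [map_mul]
    exact mul_lt_one_of_lt_of_le ((ValuationSubring.mem_nonunits_iff _).1
      (ValuationSubring.inv_mem_nonunits_of_notMem ht)) ((R.valuation_le_one_iff _).2 (hx R hR ht))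
  rw [Valuation.map_add_eq_of_lt_left _ (by rwa [h1]), h1, inv_one]

theorem Subalgebra.polynomial_aeval_mem (D : Subalgebra K L) {x : L} (hx : x ∈ D) (f : K[X]) :
    Polynomial.aeval x f ∈ D :=
  Algebra.adjoin_le (by simpa using hx) (aeval_mem_adjoin_singleton K x)

theorem inv_aeval_mem_polarRing {t : L} {u : K[X]} (hu : u.coeff 0 ≠ 0) :
    (Polynomial.aeval t⁻¹ u)⁻¹ ∈ polarRing K t := by
  have h : Polynomial.aeval t⁻¹ u = algebraMap K L (u.coeff 0) + t⁻¹ * Polynomial.aeval t⁻¹ u.divX := by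
    conv_lhs => rw [← u.divX_mul_X_add]
    simp; ring
  rw [h]
  exact inv_add_mem_polarRing (Subalgebra.polynomial_aeval_mem _ (inv_mem_polarRing t) _) hu

theorem ValuationSubring.mem_of_isIntegral (R : ValuationSubring L) (S : Subalgebra K L)
    (hS : ∀ x ∈ S, x ∈ R) {x : L} (hx : IsIntegral S x) : x ∈ R := by
  let i : S →+* R := (algebraMap S L).codRestrict R fun y => hS _ y.2
  obtain ⟨f, hf, hf'⟩ := hx
  have : IsIntegral R x := ⟨f.map i, hf.map i, by rw [Polynomial.eval₂_map]; exact hf'⟩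
  obtain ⟨y, rfl⟩ := IsIntegrallyClosed.isIntegral_iff.1 this
  exact y.2

theorem mem_polarRing_of_isIntegral {t x : L} (S : Subalgebra K L) (hS : S ≤ polarRing K t)
    (hx : IsIntegral S x) : x ∈ polarRing K t := fun R hR ht =>
  R.mem_of_isIntegral S (fun _ hy => hS hy R hR ht) hx

theorem pow_mul_mem_polarRing_of_le {t x : L} {i j : ℕ} (hij : i ≤ j)
    (h : t⁻¹ ^ i * x ∈ polarRing K t) : t⁻¹ ^ j * x ∈ polarRing K t := by
  obtain ⟨l, rfl⟩ := Nat.exists_eq_add_of_le hij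
  rw [add_comm, pow_add, mul_assoc]
  exact (polarRing K t).mul_mem ((polarRing K t).pow_mem (inv_mem_polarRing t) l) h

theorem exists_pow_mul_mem_polarRing {t : L} [Algebra.IsAlgebraic (Algebra.adjoin K {t⁻¹}) L]
    (x : L) : ∃ j : ℕ, t⁻¹ ^ j * x ∈ polarRing K t := by
  obtain ⟨y, hy, hyx⟩ := (Algebra.IsAlgebraic.isAlgebraic
    (R := Algebra.adjoin K {t⁻¹}) x).exists_integral_multiple
  obtain ⟨⟨y, hy'⟩, rfl⟩ : ∃ z : Algebra.adjoin K {t⁻¹}, z = y := ⟨y, rfl⟩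
  obtain ⟨f, rfl⟩ := Algebra.adjoin_singleton_eq_range_aeval K t⁻¹ ▸ hy'
  have hf : f ≠ 0 := by
    rintro rfl
    exact hy (Subtype.ext (map_zero (Polynomial.aeval t⁻¹)))
  obtain ⟨g, hg, hdvd⟩ := f.exists_eq_pow_rootMultiplicity_mul_and_not_dvd hf 0
  refine ⟨f.rootMultiplicity 0, ?_⟩
  have h1 : Polynomial.aeval t⁻¹ f * x ∈ polarRing K t :=
    mem_polarRing_of_isIntegral _ (Algebra.adjoin_le (by simpa using inv_mem_polarRing t)) hyx
  simp only [map_zero, sub_zero, X_dvd_iff] at hg hdvd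
  have h2 := (polarRing K t).mul_mem (inv_aeval_mem_polarRing (t := t) hdvd) h1
  have h3 : Polynomial.aeval t⁻¹ g ≠ 0 := by
    intro h0
    apply hy
    ext
    change Polynomial.aeval t⁻¹ f = 0
    rw [hg, map_mul, h0, mul_zero]
  convert h2 using 1
  conv_rhs => rw [hg]
  rw [map_mul, map_pow, Polynomial.aeval_X, ← mul_assoc, mul_left_comm, inv_mul_cancel₀ h3, mul_one]

theorem aeval_div_aeval_mem_polarRing {t : L} (ht : t ≠ 0) {r h : K[X]} (hh : h ≠ 0)
    (hr : r.natDegree ≤ h.natDegree) : Polynomial.aeval t r / Polynomial.aeval t h ∈ polarRing K t := by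
  let _ := invertibleOfNonzero (inv_ne_zero ht)
  have key (f : K[X]) (hf : f.natDegree ≤ h.natDegree) :
      Polynomial.aeval t f = Polynomial.aeval t⁻¹ (f.reflect h.natDegree) * t ^ h.natDegree := by
    let _ := invertibleOfNonzero ht
    have := eval₂_reflect_mul_pow (algebraMap K L) t _ f hf
    rw [invOf_eq_inv] at this
    exact this.symm
  rw [key r hr, key h le_rfl, mul_div_mul_right _ _ (pow_ne_zero _ ht), div_eq_mul_inv]
  refine (polarRing K t).mul_mem (Subalgebra.polynomial_aeval_mem _ (inv_mem_polarRing t) _) (inv_aeval_mem_polarRing ?_)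
  simpa using hh

theorem inv_mem_of_isPrime_polarRing {t : L} {P : Ideal (polarRing K t)} [P.IsPrime] (hP : P ≠ ⊥)
    [Algebra.IsAlgebraic (Algebra.adjoin K {t⁻¹}) L] :
    (⟨t⁻¹, inv_mem_polarRing t⟩ : polarRing K t) ∈ P := by
  obtain ⟨x, hx, hx0⟩ := Submodule.exists_mem_ne_zero_of_ne_bot hP
  obtain ⟨j, hj⟩ := exists_pow_mul_mem_polarRing (K := K) (t := t) (x : L)⁻¹
  refine Ideal.IsPrime.mem_of_pow_mem ‹_› j ?_
  convert P.mul_mem_left ⟨_, hj⟩ hx using 1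
  ext
  have : (x : L) ≠ 0 := fun h => hx0 (Subtype.ext h)
  simp [this]

theorem mk_aeval_polarRing {t : L} (g : K[X]) :
    Ideal.Quotient.mk (Ideal.span {(⟨t⁻¹, inv_mem_polarRing t⟩ : polarRing K t)})
      (Polynomial.aeval ⟨t⁻¹, inv_mem_polarRing t⟩ g) = algebraMap K _ (g.coeff 0) := by
  have := (aeval_algHom_apply (Ideal.Quotient.mkₐ K
    (Ideal.span {(⟨t⁻¹, inv_mem_polarRing t⟩ : polarRing K t)})) ⟨t⁻¹, inv_mem_polarRing t⟩ g).symm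
  refine this.trans ?_
  rw [Ideal.Quotient.mkₐ_eq_mk, Ideal.Quotient.eq_zero_iff_mem.2 (Ideal.mem_span_singleton_self _),
    ← coeff_zero_eq_aeval_zero']

theorem X_dvd_of_sum_aeval_mul_eq_zero {t : L} {ι : Type*} {b : ι → polarRing K t}
    (hb : LinearIndependent K fun i => Ideal.Quotient.mk
      (Ideal.span {(⟨t⁻¹, inv_mem_polarRing t⟩ : polarRing K t)}) (b i))
    (T : Finset ι) (f : ι → K[X]) (h : ∑ i ∈ T, Polynomial.aeval t⁻¹ (f i) * (b i : L) = 0) :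
    ∀ i ∈ T, Polynomial.X ∣ f i := by
  have h' : ∑ i ∈ T, Polynomial.aeval (⟨t⁻¹, inv_mem_polarRing t⟩ : polarRing K t) (f i) * b i = 0 := by
    apply Subtype.ext
    have e (g : K[X]) : ((Polynomial.aeval (⟨t⁻¹, inv_mem_polarRing t⟩ : polarRing K t) g :
        polarRing K t) : L) = Polynomial.aeval t⁻¹ g :=
      (aeval_algHom_apply (polarRing K t).val _ g).symm
    simpa [e] using h
  have h2 := congrArg (Ideal.Quotient.mk
    (Ideal.span {(⟨t⁻¹, inv_mem_polarRing t⟩ : polarRing K t)})) h'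
  simp only [map_sum, map_mul, mk_aeval_polarRing, map_zero, ← Algebra.smul_def] at h2
  intro i hi
  exact X_dvd_iff.2 (linearIndependent_iff'.1 hb T _ h2 i hi)

theorem linearIndependent_adjoin_of_polarRing {t : L} (ht : t ≠ 0) {ι : Type*}
    {b : ι → polarRing K t} (hb : LinearIndependent K fun i => Ideal.Quotient.mk
      (Ideal.span {(⟨t⁻¹, inv_mem_polarRing t⟩ : polarRing K t)}) (b i)) :
    LinearIndependent (Algebra.adjoin K {t⁻¹}) fun i => (b i : L) := by
  rw [linearIndependent_iff']
  intro T c hc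
  have hf (i : ι) : ∃ f : K[X], Polynomial.aeval t⁻¹ f = (c i : L) :=
    (Algebra.adjoin_singleton_eq_range_aeval K t⁻¹).le (c i).2
  choose f hf using hf
  have key (n : ℕ) : ∀ f : ι → K[X], ∑ i ∈ T, Polynomial.aeval t⁻¹ (f i) * (b i : L) = 0 →
      ∀ i ∈ T, Polynomial.X ^ n ∣ f i := by
    induction n with
    | zero => intro f _ i _; simp
    | succ n ih =>
      intro f h i hi
      have h1 := X_dvd_of_sum_aeval_mul_eq_zero hb T f h
      have e (i : ι) (hi : i ∈ T) : f i = Polynomial.X * (f i).divX := by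
        conv_lhs => rw [← (f i).X_mul_divX_add, X_dvd_iff.1 (h1 i hi)]
        simp
      have h2 : ∑ i ∈ T, Polynomial.aeval t⁻¹ (f i).divX * (b i : L) = 0 := by
        rw [Finset.sum_congr rfl fun i hi => by rw [e i hi]] at h
        simp only [map_mul, Polynomial.aeval_X, mul_assoc, ← Finset.mul_sum] at h
        exact (mul_eq_zero.1 h).resolve_left (inv_ne_zero ht)
      rw [e i hi, pow_succ']
      exact mul_dvd_mul_left _ (ih _ h2 i hi)
  have h0 : ∑ i ∈ T, Polynomial.aeval t⁻¹ (f i) * (b i : L) = 0 := by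
    simpa [hf, Algebra.smul_def] using hc
  intro i hi
  have : f i = 0 := by
    ext n
    exact X_pow_dvd_iff.1 (key (n + 1) f h0 i hi) n (Nat.lt_succ_self n)
  ext
  rw [← hf, this]
  simp

section Finite

variable {t : L} [FiniteDimensional (IntermediateField.adjoin K {t⁻¹}) L]

open scoped IntermediateField.algebraAdjoinAdjoin in
theorem finiteDimensional_polarRing_quotient_inv (ht : t ≠ 0) : FiniteDimensional K
    (polarRing K t ⧸ Ideal.span {(⟨t⁻¹, inv_mem_polarRing t⟩ : polarRing K t)}) := by
  let I := Ideal.span {(⟨t⁻¹, inv_mem_polarRing t⟩ : polarRing K t)}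
  let v := Module.Basis.ofVectorSpace K (polarRing K t ⧸ I)
  choose b hb using fun i => Ideal.Quotient.mk_surjective (v i)
  have h1 := linearIndependent_adjoin_of_polarRing ht (b := b)
    (by simpa only [I, hb] using v.linearIndependent)
  have h2 := (LinearIndependent.iff_fractionRing (Algebra.adjoin K {t⁻¹})
    (IntermediateField.adjoin K {t⁻¹})).1 h1
  have := h2.finite_of_isNoetherian
  exact Module.Finite.of_basis v

open scoped IntermediateField.algebraAdjoinAdjoin in
theorem isAlgebraic_adjoin_of_finiteDimensional :
    Algebra.IsAlgebraic (Algebra.adjoin K {t⁻¹}) L :=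
  Algebra.IsAlgebraic.trans _ (IntermediateField.adjoin K {t⁻¹}) _

theorem exists_dvd_inv_pow_polarRing {x : polarRing K t} (hx : x ≠ 0) :
    ∃ j : ℕ, x ∣ (⟨t⁻¹, inv_mem_polarRing t⟩ : polarRing K t) ^ j := by
  have := isAlgebraic_adjoin_of_finiteDimensional (K := K) (t := t)
  obtain ⟨j, hj⟩ := exists_pow_mul_mem_polarRing (K := K) (t := t) (x : L)⁻¹
  refine ⟨j, ⟨_, hj⟩, ?_⟩
  have : (x : L) ≠ 0 := fun h => hx (Subtype.ext h)
  ext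
  push_cast
  field_simp

theorem finiteDimensional_polarRing_quotient (ht : t ≠ 0) {x : polarRing K t} (hx : x ≠ 0) :
    FiniteDimensional K (polarRing K t ⧸ Ideal.span {x}) := by
  have := finiteDimensional_polarRing_quotient_inv (K := K) ht
  obtain ⟨j, hj⟩ := exists_dvd_inv_pow_polarRing hx
  have := finiteDimensional_quotient_span_pow (K := K)
    (x := (⟨t⁻¹, inv_mem_polarRing t⟩ : polarRing K t))
    (fun h => inv_ne_zero ht (congrArg Subtype.val h)) j
  have hle := Ideal.span_singleton_le_span_singleton.2 hj
  exact Module.Finite.of_surjective (Ideal.Quotient.factorₐ K hle).toLinearMap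
    (Ideal.Quotient.factor_surjective hle)

theorem isFractionRing_polarRing (ht : t ≠ 0) : IsFractionRing (polarRing K t) L := by
  have := isAlgebraic_adjoin_of_finiteDimensional (K := K) (t := t)
  refine IsFractionRing.of_field _ _ fun z => ?_
  obtain ⟨j, hj⟩ := exists_pow_mul_mem_polarRing (K := K) (t := t) z
  refine ⟨⟨_, hj⟩, ⟨t⁻¹, inv_mem_polarRing t⟩ ^ j, ?_⟩
  change z = t⁻¹ ^ j * z / t⁻¹ ^ j
  field_simp

theorem isPrincipalIdealRing_polarRing (ht : t ≠ 0) : IsPrincipalIdealRing (polarRing K t) := by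
  have := isAlgebraic_adjoin_of_finiteDimensional (K := K) (t := t)
  have := isFractionRing_polarRing (K := K) ht
  have hnoeth : IsNoetherianRing (polarRing K t) := by
    rw [isNoetherianRing_iff_ideal_fg]
    intro I
    rcases eq_or_ne I ⊥ with rfl | hI
    · exact Submodule.fg_bot
    obtain ⟨x, hx, hx0⟩ := Submodule.exists_mem_ne_zero_of_ne_bot hI
    have := finiteDimensional_polarRing_quotient ht hx0
    have := isNoetherian_of_tower K (S := polarRing K t) (M := polarRing K t ⧸ Ideal.span {x})
      inferInstance
    refine Submodule.fg_of_fg_map_of_fg_inf_ker (Submodule.mkQ (Ideal.span {x}))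
      (IsNoetherian.noetherian _) ?_
    rw [Submodule.ker_mkQ, inf_eq_right.2 ((Ideal.span_singleton_le_iff_mem _).2 hx)]
    exact Submodule.fg_span_singleton x
  have hdim : Ring.DimensionLEOne (polarRing K t) := ⟨fun {P} hP hP' => by
    obtain ⟨x, hx, hx0⟩ := Submodule.exists_mem_ne_zero_of_ne_bot hP
    have := finiteDimensional_polarRing_quotient ht hx0
    have hle := (Ideal.span_singleton_le_iff_mem P).2 hx
    have : FiniteDimensional K (polarRing K t ⧸ P) := Module.Finite.of_surjective
      (Ideal.Quotient.factorₐ K hle).toLinearMap (Ideal.Quotient.factor_surjective hle)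
    exact Ideal.Quotient.maximal_of_isField _
      (isField_of_isIntegral_of_isField' (Field.toIsField K))⟩
  have hint : IsIntegrallyClosed (polarRing K t) := by
    rw [isIntegrallyClosed_iff L]
    intro x hx
    exact ⟨⟨x, mem_polarRing_of_isIntegral _ le_rfl hx⟩, rfl⟩
  have hded : IsDedekindDomain (polarRing K t) := { hnoeth, hdim, hint with }
  refine IsPrincipalIdealRing.of_finite_maximals ?_
  let σ : polarRing K t := ⟨t⁻¹, inv_mem_polarRing t⟩
  have hσ : σ ≠ 0 := fun h => inv_ne_zero ht (congrArg Subtype.val h)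
  refine (((Ideal.finite_factors (I := Ideal.span {σ}) (by simpa using hσ)).image
    fun v => v.asIdeal).insert ⊥).subset ?_
  intro P hP
  have hP' : P.IsMaximal := hP
  rcases eq_or_ne P ⊥ with rfl | h
  · exact Set.mem_insert _ _
  · refine Set.mem_insert_of_mem _ ⟨⟨P, hP'.isPrime, h⟩, ?_, rfl⟩
    exact Ideal.dvd_iff_le.2 ((Ideal.span_singleton_le_iff_mem _).2 (inv_mem_of_isPrime_polarRing h))

end Finite
end PolarRing

section Comparison

open Polynomial

variable {K L : Type*} [Field K] [Field L] [Algebra K L]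

theorem ValuationSubring.exists_notMem_of_not_isIntegral {x : L} (hx : ¬IsIntegral K x) :
    ∃ R : ValuationSubring L, (∀ c : K, algebraMap K L c ∈ R) ∧ x ∉ R := by
  have : IsIntegrallyClosedIn (integralClosure K L).toSubring L :=
    inferInstanceAs (IsIntegrallyClosedIn (integralClosure K L) L)
  obtain ⟨R, hR, hxR⟩ := Subring.exists_le_valuationSubring_of_isIntegrallyClosedIn
    (R := (integralClosure K L).toSubring) hx
  exact ⟨R, fun c => hR ((integralClosure K L).algebraMap_mem c), hxR⟩

theorem exists_translate_sup_polarRing_eq_top {D : Subalgebra K L} {t : L}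
    (htr : Transcendental K t) (htD : t ∈ D) [Algebra.IsAlgebraic (Algebra.adjoin K {t⁻¹}) L]
    {S : Finset L} (hSD : ∀ a ∈ S, a ∈ D)
    (hS : ∀ a ∈ D, a ∈ Submodule.span (Algebra.adjoin K {t}) (S : Set L))
    (hfrac : ∀ z : L, ∃ a ∈ D, ∃ h : K[X], h ≠ 0 ∧ z = a / aeval t h) :
    ∃ m : ℕ, D.translate (t⁻¹ ^ m) ⊔ (polarRing K t).translate 1 = ⊤ := by
  have ht : t ≠ 0 := fun h => htr (h ▸ isAlgebraic_zero)
  have hm : ∃ m : ℕ, ∀ a ∈ S, t⁻¹ ^ m * a ∈ polarRing K t := by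
    choose j hj using exists_pow_mul_mem_polarRing (K := K) (t := t)
    exact ⟨S.sup j, fun a ha => pow_mul_mem_polarRing_of_le (Finset.le_sup ha) (hj a)⟩
  obtain ⟨m, hm⟩ := hm
  refine ⟨m, ?_⟩
  have key (h : K[X]) (hh : h ≠ 0) (a : L)
      (ha : a ∈ Submodule.span (Algebra.adjoin K {t}) (S : Set L)) : ∀ f : K[X],
      t⁻¹ ^ m * (aeval t f * a / aeval t h) ∈
        D.translate (t⁻¹ ^ m) ⊔ (polarRing K t).translate 1 := by
    have hh' : aeval t h ≠ 0 := fun h0 => hh ((transcendental_iff.1 htr) h h0)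
    induction ha using Submodule.span_induction with
    | mem a ha =>
      intro f
      refine Submodule.mem_sup.2 ⟨t⁻¹ ^ m * (aeval t (f / h) * a), ?_,
        (aeval t (f % h) / aeval t h) * (t⁻¹ ^ m * a), ?_, ?_⟩
      · rw [Subalgebra.mem_translate, inv_mul_cancel_left₀ (pow_ne_zero _ (inv_ne_zero ht))]
        exact D.mul_mem (D.polynomial_aeval_mem htD _) (hSD a ha)
      · rw [Subalgebra.translate_one]
        refine (polarRing K t).mul_mem (aeval_div_aeval_mem_polarRing ht hh ?_) (hm a ha)
        exact natDegree_le_natDegree (EuclideanDomain.mod_lt f hh : _ < h.degree).le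
      · have : aeval t f = aeval t h * aeval t (f / h) + aeval t (f % h) := by
          rw [← map_mul, ← map_add, EuclideanDomain.div_add_mod]
        rw [this]
        field_simp
    | zero => simp
    | add x y _ _ hx hy =>
      intro f
      convert add_mem (hx f) (hy f) using 1
      ring
    | smul c x _ hx =>
      intro f
      obtain ⟨g, hg⟩ := (Algebra.adjoin_singleton_eq_range_aeval K t).le c.2
      convert hx (f * g) using 3
      rw [map_mul, Algebra.smul_def, mul_assoc]
      congr 2
      exact hg.symm
  rw [eq_top_iff]
  rintro x -
  obtain ⟨a, ha, h, hh, hx⟩ := hfrac (t ^ m * x)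
  convert key h hh a (hS a ha) 1 using 1
  rw [map_one, one_mul, ← hx, ← mul_assoc, ← mul_pow, inv_mul_cancel₀ ht, one_pow, one_mul]

theorem eq_zero_of_mem_of_mul_mem_polarRing {D : Subalgebra K L} {t : L}
    (htr : Transcendental K t) (hD : ∀ x ∈ D, IsIntegral (Algebra.adjoin K {t}) x) {x : L}
    (hx : x ∈ D) (hx' : t * x ∈ polarRing K t) : x = 0 := by
  by_contra h0
  have hxB : x ∈ polarRing K t := by
    have ht : t ≠ 0 := fun h => htr (h ▸ isAlgebraic_zero)
    simpa [ht] using (polarRing K t).mul_mem (inv_mem_polarRing t) hx'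
  have hint : IsIntegral K x := by
    by_contra h
    obtain ⟨R, hR, hxR⟩ := ValuationSubring.exists_notMem_of_not_isIntegral h
    refine hxR (hxB R hR fun ht => hxR ?_)
    refine R.mem_of_isIntegral (Algebra.adjoin K {t}) ?_ (hD x hx)
    let R' : Subalgebra K L := { R.toSubring with algebraMap_mem' := hR }
    exact fun y hy => (Algebra.adjoin_le (S := R') (Set.singleton_subset_iff.2 ht) : _ ≤ R') hy
  obtain ⟨R, hR, ht⟩ := ValuationSubring.exists_notMem_of_not_isIntegral
    (fun h => htr h.isAlgebraic)
  refine ht ?_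
  rw [← mul_inv_cancel_right₀ h0 t]
  refine R.mul_mem _ _ (hx' R hR ht) (R.mem_of_isIntegral (⊥ : Subalgebra K L) ?_ ?_)
  · rintro _ ⟨c, rfl⟩
    exact hR c
  · exact (IsIntegral.inv hint).tower_top

theorem finiteDimensional_translate_inf_polarRing {D : Subalgebra K L} {t : L}
    (htr : Transcendental K t) (hD : ∀ x ∈ D, IsIntegral (Algebra.adjoin K {t}) x)
    [FiniteDimensional (IntermediateField.adjoin K {t⁻¹}) L] (N l : ℕ) :
    FiniteDimensional K ↥(D.translate (t⁻¹ ^ N) ⊓ (polarRing K t).translate ((t⁻¹ ^ l)⁻¹)) := by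
  have ht : t ≠ 0 := fun h => htr (h ▸ isAlgebraic_zero)
  let B := polarRing K t
  let s : B := ⟨t⁻¹, inv_mem_polarRing t⟩
  have hs : s ≠ 0 := fun h => inv_ne_zero ht (congrArg Subtype.val h)
  have := finiteDimensional_polarRing_quotient (K := K) ht (pow_ne_zero (N + l + 1) hs)
  let f : ↥(D.translate (t⁻¹ ^ N) ⊓ (polarRing K t).translate ((t⁻¹ ^ l)⁻¹)) →ₗ[K] B :=
    { toFun := fun v => ⟨((t⁻¹ ^ l)⁻¹)⁻¹ * v, v.2.2⟩
      map_add' := fun x y => by ext; simp [mul_add]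
      map_smul' := fun r x => by ext; simp }
  let g := (Ideal.Quotient.mkₐ K (Ideal.span {s ^ (N + l + 1)})).toLinearMap.comp f
  refine Module.Finite.of_injective g ((injective_iff_map_eq_zero g).2 fun v hv => ?_)
  obtain ⟨y, hy⟩ := Ideal.mem_span_singleton.1 (Ideal.Quotient.eq_zero_iff_mem.1 hv)
  have hy' : ((t⁻¹ ^ l)⁻¹)⁻¹ * (v : L) = t⁻¹ ^ (N + l + 1) * y := congrArg Subtype.val hy
  have h := eq_zero_of_mem_of_mul_mem_polarRing htr hD v.2.1 (x := (t⁻¹ ^ N)⁻¹ * v) (by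
    convert y.2 using 1
    have : (v : L) = (t⁻¹ ^ l)⁻¹ * (t⁻¹ ^ (N + l + 1) * y) := by
      rw [← hy', inv_inv, inv_mul_cancel_left₀ (pow_ne_zero _ (inv_ne_zero ht))]
    rw [this]
    simp only [pow_succ, pow_add]
    field_simp)
  ext
  simpa [ht] using h

theorem dvd_finrank_quotient_span_of_polarRing {D : Subalgebra K L} {t : L}
    (htr : Transcendental K t) (htD : t ∈ D)
    [FiniteDimensional (IntermediateField.adjoin K {t⁻¹}) L]
    {S : Finset L} (hSD : ∀ a ∈ S, a ∈ D)
    (hS : ∀ a ∈ D, a ∈ Submodule.span (Algebra.adjoin K {t}) (S : Set L))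
    (hD : ∀ x ∈ D, IsIntegral (Algebra.adjoin K {t}) x)
    (hfrac : ∀ z : L, ∃ a ∈ D, ∃ h : K[X], h ≠ 0 ∧ z = a / aeval t h) {d : ℕ}
    (hd : ∀ P : Ideal (polarRing K t), P.IsMaximal → P ≠ ⊥ →
      d ∣ Module.finrank K (polarRing K t ⧸ P)) {p : D} (hp : p ≠ 0) :
    d ∣ Module.finrank K (D ⧸ Ideal.span {p}) := by
  have ht : t ≠ 0 := fun h => htr (h ▸ isAlgebraic_zero)
  have hp' : (p : L) ≠ 0 := fun h => hp (Subtype.ext h)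
  have := isPrincipalIdealRing_polarRing (K := K) ht
  have := isAlgebraic_adjoin_of_finiteDimensional (K := K) (t := t)
  have hB (x : polarRing K t) (hx : x ≠ 0) :=
    dvd_finrank_quotient_span (fun _ => finiteDimensional_polarRing_quotient (K := K) ht) hd hx
  obtain ⟨m, hm⟩ := exists_translate_sup_polarRing_eq_top htr htD hSD hS hfrac
  obtain ⟨j, hj', hj⟩ : ∃ j, t⁻¹ ^ j * (p : L) ∈ polarRing K t ∧
      t⁻¹ ^ j * (p : L)⁻¹ ∈ polarRing K t := by
    obtain ⟨i, hi⟩ := exists_pow_mul_mem_polarRing (K := K) (t := t) (p : L)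
    obtain ⟨j, hj⟩ := exists_pow_mul_mem_polarRing (K := K) (t := t) (p : L)⁻¹
    exact ⟨max i j, pow_mul_mem_polarRing_of_le (le_max_left _ _) hi,
      pow_mul_mem_polarRing_of_le (le_max_right _ _) hj⟩
  have hσ : t⁻¹ ^ j ≠ 0 := pow_ne_zero _ (inv_ne_zero ht)
  set B := polarRing K t
  set Q := D.translate (t⁻¹ ^ (m + j))
  have hfin : FiniteDimensional K ↥(Q ⊓ B.translate ((t⁻¹ ^ j)⁻¹)) :=
    finiteDimensional_translate_inf_polarRing htr hD _ _
  have hle1 : B.translate 1 ≤ B.translate ((t⁻¹ ^ j)⁻¹) :=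
    Subalgebra.translate_le one_ne_zero
      (by simpa using B.pow_mem (inv_mem_polarRing t) j)
  have hle2 : B.translate ((p : L)⁻¹) ≤ B.translate ((t⁻¹ ^ j)⁻¹) :=
    Subalgebra.translate_le (inv_ne_zero hp') (by rwa [inv_inv, mul_comm])
  have hsup : Q ⊔ B.translate ((p : L)⁻¹) = ⊤ := by
    have h := Subalgebra.translate_sup_eq_top_mul hσ hm
    rw [← pow_add, mul_one, add_comm] at h
    refine top_le_iff.1 (h ▸ sup_le_sup_left (Subalgebra.translate_le hσ ?_) _)
    rwa [inv_inv]
  have hsup' : D.translate (t⁻¹ ^ (m + j) * p) ⊔ B.translate 1 = ⊤ := by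
    have h := Subalgebra.translate_sup_eq_top_mul hp' hsup
    rwa [mul_inv_cancel₀ hp', mul_comm] at h
  have hsup1 : Q ⊔ B.translate 1 = ⊤ := by
    refine top_le_iff.1 (hsup' ▸ sup_le_sup_right (Subalgebra.translate_le ?_ ?_) _)
    · exact mul_ne_zero (pow_ne_zero _ (inv_ne_zero ht)) hp'
    · rw [mul_right_comm, mul_inv_cancel₀ (pow_ne_zero _ (inv_ne_zero ht)), one_mul]
      exact p.2
  have hfin1 : FiniteDimensional K ↥(Q ⊓ B.translate 1) :=
    Submodule.finiteDimensional_of_le (inf_le_inf_left _ hle1)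
  have e1 := D.finrank_translate_inf (pow_ne_zero (m + j) (inv_ne_zero ht)) hp hsup'
  have e1' := ((D.translateInfEquiv B (t⁻¹ ^ (m + j)) (p : L)⁻¹ hp').finrank_eq)
  rw [mul_inv_cancel₀ hp', mul_comm (p : L)] at e1'
  have hfin2 : FiniteDimensional K ↥(B.translate ((t⁻¹ ^ j)⁻¹) ⊓ Q) := by rwa [inf_comm]
  have e2 := B.finrank_translate_inf (inv_ne_zero hσ)
    (x := (⟨t⁻¹, inv_mem_polarRing t⟩ : B) ^ j) (Q := Q)
    (fun h => hσ (congrArg Subtype.val h))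
    (by
      change B.translate ((t⁻¹ ^ j)⁻¹ * t⁻¹ ^ j) ⊔ Q = ⊤
      rw [inv_mul_cancel₀ hσ, sup_comm, hsup1])
  have e3 := B.finrank_translate_inf (inv_ne_zero hσ) (x := ⟨_, hj⟩) (Q := Q)
    (fun h => mul_ne_zero hσ (inv_ne_zero hp') (congrArg Subtype.val h))
    (by
      change B.translate ((t⁻¹ ^ j)⁻¹ * (t⁻¹ ^ j * (p : L)⁻¹)) ⊔ Q = ⊤
      rw [inv_mul_cancel_left₀ hσ, sup_comm, hsup])
  have d2 := hB ((⟨t⁻¹, inv_mem_polarRing t⟩ : B) ^ j) (fun h => hσ (congrArg Subtype.val h))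
  have d3 := hB ⟨_, hj⟩ (fun h => mul_ne_zero hσ (inv_ne_zero hp') (congrArg Subtype.val h))
  change _ = Module.finrank K ↥(B.translate ((t⁻¹ ^ j)⁻¹ * t⁻¹ ^ j) ⊓ Q) + _ at e2
  change _ = Module.finrank K ↥(B.translate ((t⁻¹ ^ j)⁻¹ * (t⁻¹ ^ j * (p : L)⁻¹)) ⊓ Q) + _ at e3
  rw [inv_mul_cancel₀ hσ, inf_comm _ Q, inf_comm _ Q] at e2
  rw [inv_mul_cancel_left₀ hσ, inf_comm _ Q, inf_comm _ Q] at e3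
  rw [← e1'] at e1
  change Module.finrank K ↥(Q ⊓ _) = Module.finrank K ↥(Q ⊓ _) + _ at e1
  refine (Nat.dvd_add_left d2).1 ?_
  convert d3 using 1
  omega

end Comparison

section ResidueDegree

variable {L : Type} [Field L] {K : Subfield L}

/-- The map from a subalgebra contained in a valuation ring to the residue field. -/
def Subalgebra.toResidue (D : Subalgebra K L) (R : ValuationSubring L) (hR : ∀ x ∈ D, x ∈ R) :
    D →+* R ⧸ IsLocalRing.maximalIdeal R :=
  (Ideal.Quotient.mk _).comp ((algebraMap D L).codRestrict R fun y => hR _ y.2)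

theorem Subalgebra.toResidue_eq_zero_iff {D : Subalgebra K L} {R : ValuationSubring L}
    {hR : ∀ x ∈ D, x ∈ R} {x : D} : D.toResidue R hR x = 0 ↔ (x : L) ∈ R.nonunits := by
  refine Iff.trans ?_ (ValuationSubring.coe_mem_nonunits_iff (a := (⟨x, hR x x.2⟩ : R))).symm
  exact Ideal.Quotient.eq_zero_iff_mem

theorem Subalgebra.toResidue_surjective {D : Subalgebra K L} [IsPrincipalIdealRing D]
    [IsFractionRing D L] {R : ValuationSubring L} {hR : ∀ x ∈ D, x ∈ R}
    (hP : RingHom.ker (D.toResidue R hR) ≠ ⊥) : Function.Surjective (D.toResidue R hR) := by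
  intro y
  obtain ⟨⟨z, hz⟩, rfl⟩ := Ideal.Quotient.mk_surjective y
  obtain ⟨a, b, hab, rfl⟩ := IsFractionRing.exists_reduced_fraction (A := D) z
  set φ := D.toResidue R hR
  have hb0 : algebraMap D L b ≠ 0 := IsFractionRing.to_map_ne_zero_of_mem_nonZeroDivisors b.2
  have hzb : Ideal.Quotient.mk (IsLocalRing.maximalIdeal R) ⟨_, hz⟩ * φ b = φ a := by
    refine (map_mul (Ideal.Quotient.mk (IsLocalRing.maximalIdeal R)) _ _).symm.trans ?_
    refine congrArg (Ideal.Quotient.mk (IsLocalRing.maximalIdeal R)) (Subtype.ext ?_)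
    exact IsLocalization.mk'_spec L a b
  have hb : (b : D) ∉ RingHom.ker φ := by
    intro hb
    rw [RingHom.mem_ker] at hb
    obtain ⟨u, v, huv⟩ := hab.isCoprime
    have := congrArg φ huv
    rw [map_add, map_mul, map_mul, ← hzb, hb, map_one] at this
    simp at this
  have hmax : (RingHom.ker φ).IsMaximal := (RingHom.ker_isPrime φ).isMaximal hP
  obtain ⟨c, i, hi, hc⟩ := hmax.exists_inv hb
  have hc' := congrArg φ hc
  rw [map_add, map_mul, (RingHom.mem_ker).1 hi, add_zero, map_one] at hc'
  refine ⟨a * c, ?_⟩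
  rw [map_mul, ← hzb, mul_assoc, mul_comm (φ b), hc', mul_one]

theorem resDeg_eq_finrank_quotient {D : Subalgebra K L} {R : ValuationSubring L}
    (hR : ∀ x ∈ D, x ∈ R) (h : Function.Surjective (D.toResidue R hR)) :
    resDeg K R = Module.finrank K (D ⧸ RingHom.ker (D.toResidue R hR)) := by
  have hK : (K : Set L) ⊆ (R : Set L) := fun x hx => hR x (D.algebraMap_mem ⟨x, hx⟩)
  rw [resDeg, dif_pos hK]
  let _ : Module K (R ⧸ IsLocalRing.maximalIdeal R) :=
    (Module.compHom _ ((Ideal.Quotient.mk (IsLocalRing.maximalIdeal R)).comp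
        { toFun := fun x => (⟨(x : L), hK x.2⟩ : R),
          map_one' := rfl, map_mul' := fun _ _ => rfl,
          map_zero' := rfl, map_add' := fun _ _ => rfl }))
  let e := RingHom.quotientKerEquivOfSurjective h
  symm
  refine LinearEquiv.finrank_eq { e with map_smul' := fun c x => ?_ }
  obtain ⟨x, rfl⟩ := Ideal.Quotient.mk_surjective x
  change D.toResidue R hR (c • x) = _
  rw [Algebra.smul_def, map_mul]
  rfl

theorem Subalgebra.exists_isMaximal_resDeg_eq {D : Subalgebra K L} [IsPrincipalIdealRing D]
    [IsFractionRing D L] {R : ValuationSubring L} (hR : ∀ x ∈ D, x ∈ R) (hR' : R ≠ ⊤) :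
    ∃ P : Ideal D, P.IsMaximal ∧ P ≠ ⊥ ∧ resDeg K R = Module.finrank K (D ⧸ P) := by
  have hP : RingHom.ker (D.toResidue R hR) ≠ ⊥ := by
    intro h
    refine hR' (top_le_iff.1 fun z _ => ?_)
    obtain ⟨a, b, hb, rfl⟩ := IsFractionRing.div_surjective (A := D) z
    rw [div_eq_mul_inv]
    refine R.mul_mem _ _ (hR _ a.2) ?_
    by_contra hb'
    have h1 : b ∈ RingHom.ker (D.toResidue R hR) := by
      refine RingHom.mem_ker.2 (toResidue_eq_zero_iff.2 ?_)
      simpa using ValuationSubring.inv_mem_nonunits_of_notMem hb'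
    rw [h] at h1
    exact nonZeroDivisors.ne_zero hb h1
  exact ⟨_, (RingHom.ker_isPrime _).isMaximal hP, hP,
    resDeg_eq_finrank_quotient hR (toResidue_surjective hP)⟩

theorem Subalgebra.exists_valuationSubring_resDeg_eq {D : Subalgebra K L}
    [IsPrincipalIdealRing D] [IsFractionRing D L] {P : Ideal D} (hP : P.IsMaximal) (hP' : P ≠ ⊥) :
    ∃ R : ValuationSubring L, (∀ x ∈ D, x ∈ R) ∧ R ≠ ⊤ ∧
      (∀ x ∈ P, (x : L) ∈ R.nonunits) ∧ resDeg K R = Module.finrank K (D ⧸ P) := by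
  obtain ⟨R, hR, hPR⟩ := Ideal.image_subset_nonunits_valuationSubring (A := D.toSubring) P
    hP.ne_top
  have hR' : ∀ x ∈ D, x ∈ R := fun x hx => hR hx
  have hPR' : ∀ x ∈ P, (x : L) ∈ R.nonunits := fun x hx => hPR ⟨x, hx, rfl⟩
  have hker : P = RingHom.ker (D.toResidue R hR') := by
    refine hP.eq_of_le (RingHom.ker_ne_top _) fun x hx => ?_
    exact RingHom.mem_ker.2 (toResidue_eq_zero_iff.2 (hPR' x hx))
  refine ⟨R, hR', ?_, hPR', ?_⟩
  · rintro rfl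
    obtain ⟨x, hx, hx0⟩ := Submodule.exists_mem_ne_zero_of_ne_bot hP'
    have h := hPR' x hx
    rw [ValuationSubring.mem_nonunits_iff_exists_mem_maximalIdeal] at h
    obtain ⟨h1, h2⟩ := h
    refine h2 ?_
    refine IsUnit.of_mul_eq_one ⟨(x : L)⁻¹, ValuationSubring.mem_top _⟩ (Subtype.ext ?_)
    exact mul_inv_cancel₀ fun h => hx0 (Subtype.ext h)
  · rw [resDeg_eq_finrank_quotient hR' (toResidue_surjective (hker ▸ hP')), ← hker]

end ResidueDegree

section FiniteOverLine

variable {L : Type} [Field L] {K : Subfield L}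

theorem dvd_resDeg_of_polarRing {t : L} (htr : Transcendental K t)
    [FiniteDimensional (IntermediateField.adjoin K {t⁻¹}) L] {d : ℕ}
    (hd : ∀ R : ValuationSubring L, (K : Set L) ⊆ R → R ≠ ⊤ → t ∉ R → d ∣ resDeg K R)
    (P : Ideal (polarRing K t)) (hP : P.IsMaximal) (hP' : P ≠ ⊥) :
    d ∣ Module.finrank K (polarRing K t ⧸ P) := by
  have ht : t ≠ 0 := fun h => htr (h ▸ isAlgebraic_zero)
  have := isPrincipalIdealRing_polarRing (K := K) ht
  have := isFractionRing_polarRing (K := K) ht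
  have := isAlgebraic_adjoin_of_finiteDimensional (K := K) (t := t)
  obtain ⟨R, hR, hR', hPR, h⟩ := Subalgebra.exists_valuationSubring_resDeg_eq hP hP'
  rw [← h]
  refine hd R (fun c hc => hR _ ((polarRing K t).algebraMap_mem ⟨c, hc⟩)) hR' fun htR => ?_
  have h1 := hPR _ (inv_mem_of_isPrime_polarRing hP')
  rw [R.inv_mem_nonunits_iff] at h1
  exact h1.elim ht fun h2 => h2 htR

theorem Subalgebra.dvd_resDeg_of_finite {D : Subalgebra K L} [IsPrincipalIdealRing D]
    [IsFractionRing D L] {g : MvPolynomial (Fin 1) K →ₐ[K] D} (hg : Function.Injective g)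
    (hfin : g.Finite) {d : ℕ}
    (hd : ∀ R : ValuationSubring L, (K : Set L) ⊆ R → R ≠ ⊤ → (∃ x ∈ D, x ∉ R) → d ∣ resDeg K R)
    {R : ValuationSubring L} (hKR : (K : Set L) ⊆ R) (hR : R ≠ ⊤) : d ∣ resDeg K R := by
  by_cases hDR : ∃ x ∈ D, x ∉ R
  · exact hd R hKR hR hDR
  push Not at hDR
  obtain ⟨P, hP, hP', hres⟩ := Subalgebra.exists_isMaximal_resDeg_eq hDR hR
  rw [hres]
  have hPspan := Submodule.IsPrincipal.span_singleton_generator P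
  rw [Ideal.submodule_span_eq] at hPspan
  rw [← hPspan]
  have hp0 : Submodule.IsPrincipal.generator P ≠ 0 := fun h =>
    hP' ((Submodule.IsPrincipal.eq_bot_iff_generator_eq_zero P).2 h)
  set t : L := (g (MvPolynomial.X 0) : L)
  have htr : Transcendental K t := by
    have h1 : AlgebraicIndependent K fun i : Fin 1 => D.val (g (MvPolynomial.X i)) :=
      (MvPolynomial.algebraicIndependent_X (Fin 1) K).map' (f := D.val.comp g)
        (Subtype.val_injective.comp hg)
    exact h1.transcendental 0
  have hgt (r : MvPolynomial (Fin 1) K) : ((g r : D) : L) ∈ Algebra.adjoin K {t} := by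
    induction r using MvPolynomial.induction_on with
    | C a =>
      rw [← MvPolynomial.algebraMap_eq, AlgHom.commutes]
      exact Subalgebra.algebraMap_mem _ a
    | add p q hp hq => rw [map_add]; exact add_mem hp hq
    | mul_X p i hp =>
      rw [map_mul, Fin.fin_one_eq_zero i]
      exact mul_mem hp (Algebra.self_mem_adjoin_singleton K t)
  let _ := g.toRingHom.toAlgebra
  have hfin' : Module.Finite (MvPolynomial (Fin 1) K) D := hfin
  obtain ⟨S, hS⟩ := hfin'.fg_top
  let S' : Finset L := S.map ⟨_, Subtype.val_injective⟩
  have hspan (a : L) (ha : a ∈ D) :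
      a ∈ Submodule.span (Algebra.adjoin K {t}) (S' : Set L) := by
    have : (⟨a, ha⟩ : D) ∈ Submodule.span (MvPolynomial (Fin 1) K) (S : Set D) := hS ▸ trivial
    have key (b : D) (hb : b ∈ Submodule.span (MvPolynomial (Fin 1) K) (S : Set D)) :
        (b : L) ∈ Submodule.span (Algebra.adjoin K {t}) (S' : Set L) := by
      induction hb using Submodule.span_induction with
      | mem x hx => exact Submodule.subset_span (by simpa [S'] using hx)
      | zero => simp
      | add x y _ _ hx hy => simpa using add_mem hx hy
      | smul r x _ hx => exact Submodule.smul_mem _ (⟨_, hgt r⟩ : Algebra.adjoin K {t}) hx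
    exact key _ this
  have hint (x : L) (hx : x ∈ D) : IsIntegral (Algebra.adjoin K {t}) x := by
    obtain ⟨f, hf, hf'⟩ := Algebra.IsIntegral.isIntegral (R := MvPolynomial (Fin 1) K) (⟨x, hx⟩ : D)
    refine ⟨f.map ((D.val.comp g).codRestrict _ hgt : _ →ₐ[K] Algebra.adjoin K {t}).toRingHom,
      hf.map _, ?_⟩
    rw [Polynomial.eval₂_map]
    have h := congrArg (D.val : D →+* L) hf'
    rw [map_zero, Polynomial.hom_eval₂] at h
    exact h
  have hfrac (z : L) : ∃ a ∈ D, ∃ h : Polynomial K, h ≠ 0 ∧ z = a / Polynomial.aeval t h := by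
    obtain ⟨a, b, hb, rfl⟩ := IsFractionRing.div_surjective (A := D) z
    obtain ⟨r, hr, c, hc⟩ := (Algebra.IsIntegral.isIntegral (R := MvPolynomial (Fin 1) K)
      b).isAlgebraic.exists_nonzero_dvd hb
    obtain ⟨h, hh⟩ := (Algebra.adjoin_singleton_eq_range_aeval K t).le (hgt r)
    have hc' : Polynomial.aeval t h = (b : L) * c := hh.trans (congrArg Subtype.val hc)
    have hbc : (b : L) * c ≠ 0 := by
      rw [← hc']
      intro h0
      refine hr (hg (Subtype.ext ?_))
      rw [map_zero]
      exact hh.symm.trans h0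
    refine ⟨a * c, D.mul_mem a.2 c.2, h, ?_, ?_⟩
    · rintro rfl
      exact hbc (by rw [← hc', map_zero])
    · rw [hc', mul_div_mul_right _ _ (right_ne_zero_of_mul hbc)]
      rfl
  have hmemE : t ∈ IntermediateField.adjoin K {t⁻¹} := by
    simpa using inv_mem (IntermediateField.mem_adjoin_simple_self K t⁻¹)
  have hleE : Algebra.adjoin K {t} ≤ (IntermediateField.adjoin K {t⁻¹}).toSubalgebra :=
    Algebra.adjoin_le (Set.singleton_subset_iff.2 hmemE)
  have hfinE : FiniteDimensional (IntermediateField.adjoin K {t⁻¹}) L := by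
    refine ⟨⟨S', ?_⟩⟩
    rw [eq_top_iff]
    rintro z -
    obtain ⟨a, ha, h, hh, rfl⟩ := hfrac z
    have h1 : a ∈ Submodule.span (IntermediateField.adjoin K {t⁻¹})
        (S' : Set L) := by
      have := hspan a ha
      clear ha
      induction this using Submodule.span_induction with
      | mem x hx => exact Submodule.subset_span hx
      | zero => simp
      | add x y _ _ hx hy => exact add_mem hx hy
      | smul r x _ hx =>
        exact Submodule.smul_mem _ (⟨_, hleE r.2⟩ : IntermediateField.adjoin K {t⁻¹}) hx
    rw [div_eq_inv_mul]
    exact Submodule.smul_mem _ (⟨_, inv_mem (hleE (Polynomial.aeval_mem_adjoin_singleton K t) :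
      Polynomial.aeval t h ∈ IntermediateField.adjoin K {t⁻¹})⟩ :
        IntermediateField.adjoin K {t⁻¹}) h1
  refine dvd_finrank_quotient_span_of_polarRing htr (g (MvPolynomial.X 0)).2 ?_ hspan hint hfrac
    (dvd_resDeg_of_polarRing htr fun R hR hR' ht => hd R hR hR' ⟨t, Subtype.prop _, ht⟩) hp0
  intro a ha
  obtain ⟨b, -, rfl⟩ := Finset.mem_map.1 ha
  exact b.2

end FiniteOverLine

section Trdeg

variable {k L : Type} [Field k] [Field L] [Algebra k L]

open scoped IntermediateField.algebraAdjoinAdjoin in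
theorem IntermediateField.trdeg_adjoin_simple {f : L} (hf : Transcendental k f) :
    Algebra.trdeg k (IntermediateField.adjoin k {f}) = 1 := by
  have h1 : Algebra.trdeg k (Algebra.adjoin k {f}) = 1 := by
    rw [← (Polynomial.algEquivOfTranscendental k f hf).trdeg_eq]
    exact Polynomial.trdeg_of_isDomain
  have h2 := trdeg_add_eq k (Algebra.adjoin k {f}) (A := IntermediateField.adjoin k {f})
  rw [← h2, h1, trdeg_eq_zero, add_zero]

theorem IntermediateField.trdeg_adjoin_simple_eq_one (hL : Algebra.trdeg k L = 2) {f : L}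
    (hf : Transcendental k f) : Algebra.trdeg (IntermediateField.adjoin k {f}) L = 1 := by
  have h := trdeg_add_eq k (IntermediateField.adjoin k {f}) (A := L)
  rw [hL, IntermediateField.trdeg_adjoin_simple hf, ← one_add_one_eq_two] at h
  exact Cardinal.eq_of_add_eq_add_left h (Cardinal.natCast_lt_aleph0 (n := 1))

variable [Algebra (MvPolynomial (Fin 2) k) L] [IsFractionRing (MvPolynomial (Fin 2) k) L]
    [IsScalarTower k (MvPolynomial (Fin 2) k) L]

variable (k L) in
theorem trdeg_eq_two : Algebra.trdeg k L = 2 := by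
  have := IsLocalization.isAlgebraic L (nonZeroDivisors (MvPolynomial (Fin 2) k))
  have h := trdeg_add_eq k (MvPolynomial (Fin 2) k) (A := L)
  rw [← h, MvPolynomial.trdeg_of_isDomain, trdeg_eq_zero]
  simp

theorem MvPolynomial.transcendental_of_forall_ne_C {σ : Type*} {F : MvPolynomial σ k}
    (hF : ∀ c : k, F ≠ MvPolynomial.C c) : Transcendental k F := by
  intro h
  have h0 : F ≠ 0 := fun h => hF 0 (by simpa using h)
  obtain ⟨r, -, hr⟩ := MvPolynomial.isUnit_iff_eq_C_of_isReduced.1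
    (IsArtinianRing.isUnit_of_isIntegral_of_nonZeroDivisor h.isIntegral (mem_nonZeroDivisors_of_ne_zero h0))
  exact hF r hr

end Trdeg
section PID

variable {L : Type} [Field L] {K : Subfield L}

theorem Subalgebra.finite_mvPolynomial_of_trdeg_eq_one {D : Subalgebra K L} [IsFractionRing D L]
    (hL : Algebra.trdeg K L = 1) [Algebra.FiniteType K D] :
    ∃ g : MvPolynomial (Fin 1) K →ₐ[K] D, Function.Injective g ∧ g.Finite := by
  obtain ⟨n, g, hg, hfin⟩ := exists_finite_inj_algHom_of_fg K D
  suffices n = 1 by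
    subst this
    exact ⟨g, hg, hfin⟩
  let _ := g.toRingHom.toAlgebra
  have : IsScalarTower K (MvPolynomial (Fin n) K) D := .of_algebraMap_eq fun x =>
    (g.commutes x).symm
  have : Module.Finite (MvPolynomial (Fin n) K) D := hfin
  have : FaithfulSMul (MvPolynomial (Fin n) K) D := (faithfulSMul_iff_algebraMap_injective _ _).2 hg
  have := IsLocalization.isAlgebraic L (nonZeroDivisors D)
  have : FaithfulSMul K D := (faithfulSMul_iff_algebraMap_injective _ _).2
    (RingHom.injective (algebraMap K D))
  have h1 := trdeg_add_eq K (MvPolynomial (Fin n) K) (A := D)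
  have h2 := trdeg_add_eq K D (A := L)
  rw [hL, ← h1, MvPolynomial.trdeg_of_isDomain, trdeg_eq_zero, trdeg_eq_zero] at h2
  simpa using h2

theorem Subalgebra.isMaximal_of_isPrime_of_finite {D : Subalgebra K L}
    {g : MvPolynomial (Fin 1) K →ₐ[K] D} (hfin : g.Finite) {P : Ideal D} (hP : P.IsPrime)
    (hP' : P ≠ ⊥) : P.IsMaximal := by
  let e := MvPolynomial.uniqueAlgEquiv K (Fin 1)
  let f : Polynomial K →+* D := (g : MvPolynomial (Fin 1) K →+* D).comp (e.symm : _ →+* _)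
  have hf : f.IsIntegral :=
    RingHom.IsIntegral.trans (e.symm : Polynomial K →+* MvPolynomial (Fin 1) K)
      (g : MvPolynomial (Fin 1) K →+* D)
      (RingHom.isIntegral_of_surjective _ e.symm.surjective) (RingHom.Finite.to_isIntegral hfin)
  algebraize [f]
  refine Ideal.isMaximal_of_isIntegral_of_isMaximal_comap (R := Polynomial K) P ?_
  refine (Ideal.IsPrime.comap _).isMaximal fun h => hP' (Ideal.eq_bot_of_comap_eq_bot h)

theorem isPrincipalIdealRing_of_fraction {A : Type*} [CommRing A] [IsDomain A]
    [UniqueFactorizationMonoid A] [Algebra A L]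
    {D : Subalgebra K L} (hA : ∀ a : A, algebraMap A L a ∈ D)
    (hfrac : ∀ x ∈ D, ∃ a b : A, algebraMap A L b ≠ 0 ∧ algebraMap A L b ∈ K ∧
      x * algebraMap A L b = algebraMap A L a)
    (hinj : Function.Injective (algebraMap A L))
    (hmax : ∀ P : Ideal D, P.IsPrime → P ≠ ⊥ → P.IsMaximal) : IsPrincipalIdealRing D := by
  refine .of_prime_ne_bot fun P hP hP0 => ?_
  let φ : A →+* D := (algebraMap A L).codRestrict D hA
  have hunit (b : A) (hb0 : algebraMap A L b ≠ 0) (hb : algebraMap A L b ∈ K) :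
      IsUnit (φ b) := by
    refine IsUnit.of_mul_eq_one ⟨(algebraMap A L b)⁻¹,
      D.algebraMap_mem (⟨_, K.inv_mem hb⟩ : K)⟩ (Subtype.ext (mul_inv_cancel₀ hb0))
  have hfrac' (x : D) : ∃ a b : A, IsUnit (φ b) ∧ x * φ b = φ a := by
    obtain ⟨a, b, hb0, hb, h⟩ := hfrac x x.2
    exact ⟨a, b, hunit b hb0 hb, Subtype.ext h⟩
  have hcomap : P.comap φ ≠ ⊥ := by
    obtain ⟨x, hx, hx0⟩ := Submodule.exists_mem_ne_zero_of_ne_bot hP0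
    obtain ⟨a, b, hb, h⟩ := hfrac' x
    refine (Submodule.ne_bot_iff _).2 ⟨a, ?_, ?_⟩
    · rw [Ideal.mem_comap, ← h]
      exact P.mul_mem_right _ hx
    · rintro rfl
      rw [map_zero] at h
      exact mul_ne_zero hx0 hb.ne_zero h
  obtain ⟨p, hpP, hp⟩ := (Ideal.IsPrime.comap φ (K := P)).exists_mem_prime_of_ne_bot hcomap
  have hnd (b : A) (hb : IsUnit (φ b)) : ¬ p ∣ b := fun h =>
    hP.ne_top (P.eq_top_of_isUnit_mem hpP (isUnit_of_dvd_unit (map_dvd φ h) hb))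
  have hprime : Prime (φ p) := by
    refine ⟨?_, fun h => hP.ne_top (P.eq_top_of_isUnit_mem hpP h), fun x y hxy => ?_⟩
    · intro h
      exact hp.ne_zero (hinj (by rw [map_zero]; exact congrArg Subtype.val h))
    · obtain ⟨z, hz⟩ := hxy
      obtain ⟨a, b, hb, hx⟩ := hfrac' x
      obtain ⟨a', b', hb', hy⟩ := hfrac' y
      obtain ⟨c, e, he, hz'⟩ := hfrac' z
      have h : a * a' * e = p * (c * b * b') := by
        apply hinj
        have : φ (a * a' * e) = φ (p * (c * b * b')) := by
          simp only [map_mul, ← hx, ← hy, ← hz']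
          calc x * φ b * (y * φ b') * φ e = x * y * φ b * φ b' * φ e := by ring
            _ = _ := by rw [hz]; ring
        exact congrArg Subtype.val this
      have h2 : p ∣ a * a' := (hp.dvd_or_dvd (Dvd.intro _ h.symm)).resolve_right (hnd e he)
      refine (hp.dvd_or_dvd h2).imp (fun h3 => ?_) fun h3 => ?_
      · have := map_dvd φ h3
        rw [← hx] at this
        exact (hb.dvd_mul_right).1 this
      · have := map_dvd φ h3
        rw [← hy] at this
        exact (hb'.dvd_mul_right).1 this
  have hmax' := hmax _ ((Ideal.span_singleton_prime hprime.ne_zero).2 hprime)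
    (by simpa using hprime.ne_zero)
  rw [← hmax'.eq_of_le hP.ne_top ((Ideal.span_singleton_le_iff_mem _).2 hpP)]
  exact ⟨⟨φ p, rfl⟩⟩

end PID

section FieldGenerator

variable {k L : Type} [Field k] [Field L] [Algebra k L]

theorem trdeg_subfieldClosure (hL : Algebra.trdeg k L = 2) {f : L} (hf : Transcendental k f) :
    Algebra.trdeg (Subfield.closure (Set.range (algebraMap k L) ∪ {f})) L = 1 :=
  IntermediateField.trdeg_adjoin_simple_eq_one hL hf

theorem IntermediateField.adjoin_subfieldClosure_eq_top {f g : L}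
    (h : IntermediateField.adjoin k {f, g} = ⊤) :
    IntermediateField.adjoin (Subfield.closure (Set.range (algebraMap k L) ∪ {f})) {g} = ⊤ := by
  rw [← top_le_iff]
  rintro x -
  have hx : x ∈ IntermediateField.adjoin k {f, g} := h ▸ IntermediateField.mem_top
  suffices h : Subfield.closure (Set.range (algebraMap k L) ∪ {f, g}) ≤
      (IntermediateField.adjoin (Subfield.closure (Set.range (algebraMap k L) ∪ {f}))
        {g}).toSubfield from h hx
  have hK {y : L} (hy : y ∈ Subfield.closure (Set.range (algebraMap k L) ∪ {f})) :
      y ∈ IntermediateField.adjoin (Subfield.closure (Set.range (algebraMap k L) ∪ {f})) {g} :=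
    IntermediateField.algebraMap_mem _
      (⟨y, hy⟩ : Subfield.closure (Set.range (algebraMap k L) ∪ {f}))
  rw [Subfield.closure_le]
  rintro y (⟨c, rfl⟩ | rfl | rfl)
  · exact hK (Subfield.subset_closure (Or.inl ⟨c, rfl⟩))
  · exact hK (Subfield.subset_closure (Or.inr rfl))
  · exact IntermediateField.mem_adjoin_simple_self _ _

variable {K : Subfield L}

theorem transcendental_of_adjoin_simple_eq_top (hL : Algebra.trdeg K L = 1) {g : L}
    (hg : IntermediateField.adjoin K {g} = ⊤) : Transcendental K g := by
  intro h
  have : Algebra.IsAlgebraic K L := by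
    have := IntermediateField.isAlgebraic_adjoin_simple h.isIntegral
    rw [hg] at this
    exact (IntermediateField.topEquiv (F := K) (E := L)).isAlgebraic
  exact zero_ne_one (trdeg_eq_zero.symm.trans hL)

open scoped IntermediateField.algebraAdjoinAdjoin in
theorem isFractionRing_adjoin_of_adjoin_eq_top {s : Set L}
    (hs : IntermediateField.adjoin K s = ⊤) : IsFractionRing (Algebra.adjoin K s) L := by
  refine IsFractionRing.of_field _ _ fun x => ?_
  have hx : x ∈ IntermediateField.adjoin K s := hs ▸ IntermediateField.mem_top
  obtain ⟨a, b, h⟩ := IsFractionRing.div_surjective (Algebra.adjoin K s) (⟨x, hx⟩ :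
    IntermediateField.adjoin K s)
  exact ⟨a, b, (congrArg Subtype.val h.2).symm⟩

theorem exists_resDeg_eq_one {g : L} (hgt : Transcendental K g)
    (hg : IntermediateField.adjoin K {g} = ⊤) :
    ∃ R : ValuationSubring L, (K : Set L) ⊆ R ∧ R ≠ ⊤ ∧ resDeg K R = 1 := by
  let e := Polynomial.algEquivOfTranscendental K g hgt
  have := isFractionRing_adjoin_of_adjoin_eq_top hg
  have : IsPrincipalIdealRing (Algebra.adjoin K {g}) :=
    IsPrincipalIdealRing.of_surjective (e : Polynomial K →+* Algebra.adjoin K {g}) e.surjective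
  let φ : Algebra.adjoin K {g} →ₐ[K] K :=
    (Polynomial.aeval (R := K) (0 : K)).comp (e.symm : Algebra.adjoin K {g} →ₐ[K] Polynomial K)
  have hφ : Function.Surjective φ := fun c => ⟨algebraMap K _ c, φ.commutes c⟩
  have hP0 : RingHom.ker φ ≠ ⊥ := by
    refine (Submodule.ne_bot_iff _).2 ⟨e Polynomial.X, ?_, ?_⟩
    · simp [φ]
    · simp
  obtain ⟨R, hD, hR, -, hdeg⟩ := Subalgebra.exists_valuationSubring_resDeg_eq
    (RingHom.ker_isMaximal_of_surjective φ hφ) hP0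
  refine ⟨R, fun c hc => hD _ ((Algebra.adjoin K {g}).algebraMap_mem ⟨c, hc⟩), hR, ?_⟩
  rw [hdeg, (Ideal.quotientKerAlgEquivOfSurjective hφ).toLinearEquiv.finrank_eq,
    Module.finrank_self]

end FieldGenerator

section Plane

variable {k L : Type} [Field k] [Field L] [Algebra k L]
    {A : Type*} [CommRing A] [Algebra A L]

theorem exists_algebraMap_eq_of_mem_subringClosure [Algebra k A] [IsScalarTower k A L] {F : A}
    {x : L} (hx : x ∈ Subring.closure (Set.range (algebraMap k L) ∪ {algebraMap A L F})) :
    ∃ a : A, algebraMap A L a = x := by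
  have : Subring.closure (Set.range (algebraMap k L) ∪ {algebraMap A L F}) ≤
      (algebraMap A L).range := by
    rw [Subring.closure_le]
    rintro y (⟨c, rfl⟩ | rfl)
    · exact ⟨algebraMap k A c, (IsScalarTower.algebraMap_apply k A L c).symm⟩
    · exact ⟨F, rfl⟩
  exact this hx

theorem exists_mul_algebraMap_eq_of_mem_subfieldClosure [Algebra k A] [IsScalarTower k A L] {F : A}
    {x : L} (hx : x ∈ Subfield.closure (Set.range (algebraMap k L) ∪ {algebraMap A L F})) :
    ∃ a b : A, algebraMap A L b ≠ 0 ∧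
      algebraMap A L b ∈ Subfield.closure (Set.range (algebraMap k L) ∪ {algebraMap A L F}) ∧
      x * algebraMap A L b = algebraMap A L a := by
  obtain ⟨y, hy, z, hz, rfl⟩ := Subfield.mem_closure_iff.1 hx
  obtain rfl | hz0 := eq_or_ne z 0
  · exact ⟨0, 1, by simp, by simp [one_mem], by simp⟩
  obtain ⟨a, rfl⟩ := exists_algebraMap_eq_of_mem_subringClosure hy
  obtain ⟨b, rfl⟩ := exists_algebraMap_eq_of_mem_subringClosure hz
  exact ⟨a, b, hz0, Subfield.subring_closure_le _ hz, div_mul_cancel₀ _ hz0⟩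

theorem Algebra.exists_mul_algebraMap_eq_of_mem_adjoin {K : Subfield L}
    (hK : ∀ x ∈ K, ∃ a b : A, algebraMap A L b ≠ 0 ∧ algebraMap A L b ∈ K ∧
      x * algebraMap A L b = algebraMap A L a) {s : Set A} {x : L}
    (hx : x ∈ Algebra.adjoin K (algebraMap A L '' s)) :
    ∃ a b : A, algebraMap A L b ≠ 0 ∧ algebraMap A L b ∈ K ∧
      x * algebraMap A L b = algebraMap A L a := by
  induction hx using Algebra.adjoin_induction with
  | mem x hx =>
    obtain ⟨a, -, rfl⟩ := hx
    exact ⟨a, 1, by simp, by simp [one_mem], by simp⟩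
  | algebraMap c => exact hK c c.2
  | add x y _ _ hx hy =>
    obtain ⟨a, b, hb0, hb, h⟩ := hx
    obtain ⟨a', b', hb0', hb', h'⟩ := hy
    refine ⟨a * b' + a' * b, b * b', ?_, ?_, ?_⟩
    · rw [map_mul]; exact mul_ne_zero hb0 hb0'
    · rw [map_mul]; exact mul_mem hb hb'
    · simp only [map_mul, map_add, ← h, ← h']; ring
  | mul x y _ _ hx hy =>
    obtain ⟨a, b, hb0, hb, h⟩ := hx
    obtain ⟨a', b', hb0', hb', h'⟩ := hy
    refine ⟨a * a', b * b', ?_, ?_, ?_⟩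
    · rw [map_mul]; exact mul_ne_zero hb0 hb0'
    · rw [map_mul]; exact mul_mem hb hb'
    · simp only [map_mul, ← h, ← h']; ring

theorem algebraMap_mem_adjoin_range_X [Algebra (MvPolynomial (Fin 2) k) L]
    [IsScalarTower k (MvPolynomial (Fin 2) k) L] {K : Subfield L}
    (hK : ∀ c : k, algebraMap k L c ∈ K) (a : MvPolynomial (Fin 2) k) :
    algebraMap (MvPolynomial (Fin 2) k) L a ∈
      Algebra.adjoin K (algebraMap (MvPolynomial (Fin 2) k) L '' Set.range MvPolynomial.X) := by
  induction a using MvPolynomial.induction_on with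
  | C c =>
    rw [← MvPolynomial.algebraMap_eq, ← IsScalarTower.algebraMap_apply]
    exact Subalgebra.algebraMap_mem _ (⟨_, hK c⟩ : K)
  | add p q hp hq => rw [map_add]; exact add_mem hp hq
  | mul_X p i hp =>
    rw [map_mul]
    exact mul_mem hp (Algebra.subset_adjoin ⟨_, ⟨i, rfl⟩, rfl⟩)

theorem dvd_resDeg_of_forall_dicritical [Algebra (MvPolynomial (Fin 2) k) L]
    [IsFractionRing (MvPolynomial (Fin 2) k) L] [IsScalarTower k (MvPolynomial (Fin 2) k) L]
    {F : MvPolynomial (Fin 2) k} (hF : ∀ c : k, F ≠ MvPolynomial.C c) {K : Subfield L}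
    (hK : K = Subfield.closure (Set.range (algebraMap k L) ∪
      {algebraMap (MvPolynomial (Fin 2) k) L F})) {d : ℕ}
    (hd : ∀ R : ValuationSubring L, (K : Set L) ⊆ R → R ≠ ⊤ →
      (∃ a : MvPolynomial (Fin 2) k, algebraMap (MvPolynomial (Fin 2) k) L a ∉ R) →
      d ∣ resDeg K R) {R : ValuationSubring L} (hKR : (K : Set L) ⊆ R) (hR : R ≠ ⊤) :
    d ∣ resDeg K R := by
  set A := MvPolynomial (Fin 2) k
  have hinj : Function.Injective (algebraMap A L) := IsFractionRing.injective A L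
  have htr : Algebra.trdeg K L = 1 := by
    subst hK
    exact trdeg_subfieldClosure (trdeg_eq_two k L)
      ((transcendental_algebraMap_iff hinj).2 (MvPolynomial.transcendental_of_forall_ne_C hF))
  let D := Algebra.adjoin K (algebraMap A L '' Set.range MvPolynomial.X)
  have hA : ∀ a : A, algebraMap A L a ∈ D := algebraMap_mem_adjoin_range_X fun c =>
    hK ▸ Subfield.subset_closure (Or.inl ⟨c, rfl⟩)
  have : Algebra.FiniteType K D := .adjoin_of_finite ((Set.finite_range _).image _)
  have : IsFractionRing D L := IsFractionRing.of_field _ _ fun x => by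
    obtain ⟨a, b, -, h⟩ := IsFractionRing.div_surjective A x
    exact ⟨⟨_, hA a⟩, ⟨_, hA b⟩, h.symm⟩
  obtain ⟨g, hg, hfin⟩ := Subalgebra.finite_mvPolynomial_of_trdeg_eq_one (D := D) htr
  have : IsPrincipalIdealRing D := isPrincipalIdealRing_of_fraction hA
    (fun x hx => Algebra.exists_mul_algebraMap_eq_of_mem_adjoin
      (fun y hy => by subst hK; exact exists_mul_algebraMap_eq_of_mem_subfieldClosure hy) hx)
    hinj (fun P hP hP' => Subalgebra.isMaximal_of_isPrime_of_finite hfin hP hP')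
  refine Subalgebra.dvd_resDeg_of_finite hg hfin (fun R' hKR' hR' ⟨x, hx, hxR⟩ => ?_) hKR hR
  refine hd R' hKR' hR' ?_
  by_contra! h
  let S : Subalgebra K L := { R'.toSubring with algebraMap_mem' := fun c => hKR' c.2 }
  have : D ≤ S := Algebra.adjoin_le (by rintro _ ⟨a, -, rfl⟩; exact h a)
  exact hxR (this hx)

end Plane

/-- Let `A = k[X,Y]`, `L = Frac A`, `F ∈ A \ k`, and `K = k(F) ⊆ L`. The gcd of
the residue degrees over the dicriticals (valuation rings `R` of `L/K` with `A ⊄ R`) equals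
`η(L/K)`, the gcd of the residue degrees over all valuation rings of `L/K`. (Two gcd's of sets
of naturals are equal iff the sets have the same common divisors, which is how the equality is
expressed.) In particular if `F` is a field generator then the former gcd is `1`. -/
theorem stmt11 (k : Type) [Field k] (L : Type) [Field L]
    [Algebra (MvPolynomial (Fin 2) k) L] [IsFractionRing (MvPolynomial (Fin 2) k) L]
    [Algebra k L] [IsScalarTower k (MvPolynomial (Fin 2) k) L]
    (F : MvPolynomial (Fin 2) k) (hF : ∀ c : k, F ≠ C c) :
    (∀ d : ℕ,
      (∀ R : ValuationSubring L,
          ((Subfield.closure (Set.range (algebraMap k L)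
              ∪ {algebraMap (MvPolynomial (Fin 2) k) L F}) : Subfield L) : Set L) ⊆ (R : Set L) →
          R ≠ ⊤ → (∃ a : MvPolynomial (Fin 2) k, algebraMap (MvPolynomial (Fin 2) k) L a ∉ R) →
          d ∣ resDeg (Subfield.closure (Set.range (algebraMap k L)
              ∪ {algebraMap (MvPolynomial (Fin 2) k) L F})) R)
      ↔ (∀ R : ValuationSubring L,
          ((Subfield.closure (Set.range (algebraMap k L)
              ∪ {algebraMap (MvPolynomial (Fin 2) k) L F}) : Subfield L) : Set L) ⊆ (R : Set L) →
          R ≠ ⊤ →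
          d ∣ resDeg (Subfield.closure (Set.range (algebraMap k L)
              ∪ {algebraMap (MvPolynomial (Fin 2) k) L F})) R))
    ∧ ((∃ g : L, IntermediateField.adjoin k
          {algebraMap (MvPolynomial (Fin 2) k) L F, g} = ⊤) →
        ∀ d : ℕ,
        (∀ R : ValuationSubring L,
          ((Subfield.closure (Set.range (algebraMap k L)
              ∪ {algebraMap (MvPolynomial (Fin 2) k) L F}) : Subfield L) : Set L) ⊆ (R : Set L) →
          R ≠ ⊤ → (∃ a : MvPolynomial (Fin 2) k, algebraMap (MvPolynomial (Fin 2) k) L a ∉ R) →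
          d ∣ resDeg (Subfield.closure (Set.range (algebraMap k L)
              ∪ {algebraMap (MvPolynomial (Fin 2) k) L F})) R) →
        d = 1) := by
  have h1 := fun d : ℕ => @dvd_resDeg_of_forall_dicritical k L _ _ _ _ _ _ F hF _ rfl d
  refine ⟨fun d => ⟨fun hd R hKR hR => h1 d hd hKR hR, fun hd R hKR hR _ => hd R hKR hR⟩, ?_⟩
  rintro ⟨g, hg⟩ d hd
  have hgen := IntermediateField.adjoin_subfieldClosure_eq_top hg
  have htr := trdeg_subfieldClosure (trdeg_eq_two k L)
    ((transcendental_algebraMap_iff (IsFractionRing.injective (MvPolynomial (Fin 2) k) L)).2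
      (MvPolynomial.transcendental_of_forall_ne_C hF))
  obtain ⟨R, hKR, hR, hdeg⟩ :=
    exists_resDeg_eq_one (transcendental_of_adjoin_simple_eq_top htr hgen) hgen
  exact Nat.dvd_one.1 (hdeg ▸ h1 d hd hKR hR)
end
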